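/- Let M be a smooth hypersurface of R^{n+1}, p ≥ 1, and a ∈ [0,n). Then for every φ ∈ C^1_c(M): (n−a)∫_M |φ|^p/|x|^a dV + a∫_M ((x/|x|)·ν_M)^2 |φ|^p/|x|^a dV ≤ (∫_M |φ|^p/|x|^a dV)^{(p−1)/p} (∫_M |p∇_T φ − Hν_M φ|^p / |x|^{a−p} dV)^{1/p}. -/

import Mathlib

open MeasureTheory
open scoped RealInnerProductSpace

noncomputable section

/-- Ambient Euclidean space `ℝ^{n+1}`. -/
abbrev Eu (n : ℕ) := EuclideanSpace ℝ (Fin (n + 1))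

/-- A smooth `n`-dimensional hypersurface of `ℝ^{n+1}`, described by its carrier set
together with a smooth unit normal field; locally it is a regular level set of a
smooth function. -/
structure Hypersurface (n : ℕ) where
  carrier : Set (Eu n)
  nu : Eu n → Eu n
  smooth_nu : ContDiff ℝ (⊤ : ℕ∞) nu
  unit_nu : ∀ x ∈ carrier, ‖nu x‖ = 1
  locally_level_set : ∀ x ∈ carrier, ∃ U : Set (Eu n), IsOpen U ∧ x ∈ U ∧
    ∃ f : Eu n → ℝ, ContDiff ℝ (⊤ : ℕ∞) f ∧
      carrier ∩ U = {y ∈ U | f y = 0} ∧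
      (∀ y ∈ U, gradient f y ≠ 0) ∧
      (∀ y ∈ carrier ∩ U, nu y = ‖gradient f y‖⁻¹ • gradient f y)

variable {n : ℕ}

/-- The `i`-th tangential derivative `δ_i φ = ∂_i φ − ν^i ∑_j (∂_j φ) ν^j`. -/
def tderiv (ν : Eu n → Eu n) (i : Fin (n + 1)) (φ : Eu n → ℝ) (x : Eu n) : ℝ :=
  fderiv ℝ φ x (EuclideanSpace.single i 1)
    - ν x i * ∑ j, fderiv ℝ φ x (EuclideanSpace.single j 1) * ν x j

/-- The tangential gradient `∇_T φ = ∇φ − (∇φ·ν)ν`. -/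
def tgrad (ν : Eu n → Eu n) (φ : Eu n → ℝ) (x : Eu n) : Eu n :=
  gradient φ x - ⟪gradient φ x, ν x⟫ • ν x

/-- The tangential divergence `div_T Z = ∑ i δ_i Z^i`. -/
def tdiv (ν : Eu n → Eu n) (Z : Eu n → Eu n) (x : Eu n) : ℝ :=
  ∑ i, tderiv ν i (fun y => Z y i) x

/-- The mean curvature `H = div_T ν` (sum of the principal curvatures). -/
def meanCurv (M : Hypersurface n) (x : Eu n) : ℝ := tdiv M.nu M.nu x

/-- The Laplace–Beltrami operator `Δφ = div_T (∇_T φ)`. -/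
def lapBel (ν : Eu n → Eu n) (φ : Eu n → ℝ) (x : Eu n) : ℝ := tdiv ν (tgrad ν φ) x

/-- The surface measure on `M`: the `n`-dimensional Hausdorff measure restricted
to the carrier of `M`. -/
def surfMeasure (M : Hypersurface n) : Measure (Eu n) :=
  (μH[(n : ℝ)]).restrict M.carrier

/-- `C^1` functions with compact support in a set `S`: ambient `C^1` functions
vanishing on `S` outside a compact subset `K ⊆ S`. -/
def C1cOn (S : Set (Eu n)) (φ : Eu n → ℝ) : Prop :=
  ContDiff ℝ 1 φ ∧ ∃ K : Set (Eu n), IsCompact K ∧ K ⊆ S ∧ ∀ x ∈ S, x ∉ K → φ x = 0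

set_option linter.unusedSectionVars false

section areaformula
open Measure Set Filter Topology Module
open scoped NNReal ENNReal

theorem hmeas_compare {X Y Z : Type*} [PseudoEMetricSpace X] [MetricSpace Y] [MetricSpace Z]
    [Nonempty Z]
    [MeasurableSpace Y] [BorelSpace Y] [MeasurableSpace Z] [BorelSpace Z]
    (f : X → Y) (h : X → Z) (A : Set X) (K : ℝ≥0) {d : ℝ} (hd : 0 ≤ d)
    (H : ∀ x ∈ A, ∀ y ∈ A, dist (h x) (h y) ≤ K * dist (f x) (f y)) :
    μH[d] (h '' A) ≤ (K : ℝ≥0∞) ^ d * μH[d] (f '' A) := by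
  classical
  let k : Y → Z := fun y => if hy : y ∈ f '' A then h hy.choose else Classical.arbitrary Z
  have hk : ∀ x ∈ A, k (f x) = h x := by
    intro x hx
    have hy : f x ∈ f '' A := ⟨x, hx, rfl⟩
    have h1 : k (f x) = h hy.choose := by simp only [k]; rw [dif_pos hy]
    rw [h1, ← dist_le_zero]
    have := H _ hy.choose_spec.1 x hx
    rw [hy.choose_spec.2] at this
    simpa using this
  have himg : h '' A = k '' (f '' A) := by
    rw [image_image]
    exact image_congr fun x hx => (hk x hx).symm
  rw [himg]
  apply LipschitzOnWith.hausdorffMeasure_image_le _ hd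
  apply LipschitzOnWith.of_dist_le_mul
  rintro _ ⟨x, hx, rfl⟩ _ ⟨y, hy, rfl⟩
  rw [hk x hx, hk y hy]
  exact H x hx y hy

variable {W E : Type*} [NormedAddCommGroup W] [InnerProductSpace ℝ W] [FiniteDimensional ℝ W]
  [MeasurableSpace W] [BorelSpace W]
  [NormedAddCommGroup E] [InnerProductSpace ℝ E] [FiniteDimensional ℝ E]
  [MeasurableSpace E] [BorelSpace E]

/-- area factor -/
def areaJ (v : W) : ℝ := Real.sqrt (1 + ‖v‖ ^ 2)

theorem areaJ_sq (v : W) : areaJ v ^ 2 = 1 + ‖v‖ ^ 2 := by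
  unfold areaJ; rw [Real.sq_sqrt (by positivity)]

theorem areaJ_one_le (v : W) : 1 ≤ areaJ v := by
  unfold areaJ; rw [Real.one_le_sqrt]; nlinarith [sq_nonneg ‖v‖]

/-- symmetric stretch -/
def stretch (v : W) : W →ₗ[ℝ] W :=
  LinearMap.transvection (innerₛₗ ℝ v) ((1 + areaJ v)⁻¹ • v)

theorem stretch_det (v : W) : LinearMap.det (stretch v) = areaJ v := by
  unfold stretch
  rw [LinearMap.transvection.det]
  have h1 := areaJ_one_le v
  have h2 := areaJ_sq v
  have h3 : 1 + areaJ v ≠ 0 := by positivity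
  simp
  field_simp
  nlinarith

theorem stretch_norm_sq (v w : W) : ‖stretch v w‖ ^ 2 = ‖w‖ ^ 2 + ⟪v, w⟫ ^ 2 := by
  have h1 := areaJ_one_le v
  have h2 := areaJ_sq v
  have h3 : 1 + areaJ v ≠ 0 := by positivity
  have h4 : stretch v w = w + (⟪v, w⟫ * (1 + areaJ v)⁻¹) • v := by
    simp [stretch, LinearMap.transvection.apply, smul_smul]
  rw [h4, norm_add_sq_real, norm_smul, mul_pow, inner_smul_right, real_inner_comm w v]
  have h5 : ‖v‖ ^ 2 = areaJ v ^ 2 - 1 := by linarith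
  rw [h5, Real.norm_eq_abs, sq_abs]
  field_simp
  ring

theorem stretch_det_meas (v : W) (A : Set W) :
    μH[(finrank ℝ W : ℝ)] (stretch v '' A) = ENNReal.ofReal (areaJ v) * μH[(finrank ℝ W : ℝ)] A := by
  rw [addHaar_image_linearMap, stretch_det, abs_of_nonneg]
  linarith [areaJ_one_le v]

end areaformula

section areaformula2
open Measure Set Filter Topology Module
open scoped NNReal ENNReal

variable {W E : Type*} [NormedAddCommGroup W] [InnerProductSpace ℝ W] [FiniteDimensional ℝ W]
  [MeasurableSpace W] [BorelSpace W] [CompleteSpace W]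
  [NormedAddCommGroup E] [InnerProductSpace ℝ E] [FiniteDimensional ℝ E]
  [MeasurableSpace E] [BorelSpace E]

/-- graph parametrisation -/
def graphF (x0 : E) (ι : W →ₗᵢ[ℝ] E) (ν0 : E) (g : W → ℝ) (w : W) : E := x0 + ι w + g w • ν0

theorem graphF_norm_sq (x0 : E) (ι : W →ₗᵢ[ℝ] E) (ν0 : E) (hν : ‖ν0‖ = 1)
    (ho : ∀ w, ⟪ι w, ν0⟫ = 0) (g : W → ℝ) (w w' : W) :
    ‖graphF x0 ι ν0 g w - graphF x0 ι ν0 g w'‖ ^ 2 = ‖w - w'‖ ^ 2 + (g w - g w') ^ 2 := by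
  have h : graphF x0 ι ν0 g w - graphF x0 ι ν0 g w' = ι (w - w') + (g w - g w') • ν0 := by
    unfold graphF; rw [map_sub, sub_smul]; abel
  rw [h, norm_add_sq_real, inner_smul_right, ho, norm_smul, hν, ι.norm_map, Real.norm_eq_abs]
  simp

theorem graphF_dist_le (x0 : E) (ι : W →ₗᵢ[ℝ] E) (ν0 : E) (hν : ‖ν0‖ = 1)
    (ho : ∀ w, ⟪ι w, ν0⟫ = 0) (g : W → ℝ) (w w' : W) :
    ‖w - w'‖ ≤ ‖graphF x0 ι ν0 g w - graphF x0 ι ν0 g w'‖ := by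
  have := graphF_norm_sq x0 ι ν0 hν ho g w w'
  apply le_of_sq_le_sq _ (norm_nonneg _)
  nlinarith [sq_nonneg (g w - g w')]

theorem graphF_antilip (x0 : E) (ι : W →ₗᵢ[ℝ] E) (ν0 : E) (hν : ‖ν0‖ = 1)
    (ho : ∀ w, ⟪ι w, ν0⟫ = 0) (g : W → ℝ) : AntilipschitzWith 1 (graphF x0 ι ν0 g) := by
  apply AntilipschitzWith.of_le_mul_dist
  intro x y
  rw [dist_eq_norm, dist_eq_norm]
  simpa using graphF_dist_le x0 ι ν0 hν ho g x y

theorem graphF_lip (x0 : E) (ι : W →ₗᵢ[ℝ] E) (ν0 : E) (hν : ‖ν0‖ = 1)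
    (g : W → ℝ) (C : ℝ≥0) (hC : LipschitzWith C g) :
    LipschitzWith (1 + C) (graphF x0 ι ν0 g) := by
  apply LipschitzWith.of_dist_le_mul
  intro w w'
  rw [dist_eq_norm, dist_eq_norm]
  have h : graphF x0 ι ν0 g w - graphF x0 ι ν0 g w' = ι (w - w') + (g w - g w') • ν0 := by
    unfold graphF; rw [map_sub, sub_smul]; abel
  rw [h]
  refine (norm_add_le _ _).trans ?_
  rw [norm_smul, hν, ι.norm_map]
  have := hC.dist_le_mul w w'
  rw [Real.dist_eq, dist_eq_norm] at this
  push_cast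
  rw [Real.norm_eq_abs]
  linarith

theorem graphF_closedEmb (x0 : E) (ι : W →ₗᵢ[ℝ] E) (ν0 : E) (hν : ‖ν0‖ = 1)
    (ho : ∀ w, ⟪ι w, ν0⟫ = 0) (g : W → ℝ) (hg : Continuous g) :
    IsClosedEmbedding (graphF x0 ι ν0 g) := by
  obtain ⟨r⟩ : Nonempty W := ⟨0⟩
  have hc : Continuous (graphF x0 ι ν0 g) := by
    unfold graphF
    have := ι.continuous
    fun_prop
  have ha := graphF_antilip x0 ι ν0 hν ho g
  apply IsClosedEmbedding.of_continuous_injective_isClosedMap hc ha.injective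
  have := ha.tendsto_cobounded
  rw [Metric.cobounded_eq_cocompact, Metric.cobounded_eq_cocompact] at this
  have hp : IsProperMap (graphF x0 ι ν0 g) := by
    rw [isProperMap_iff_tendsto_cocompact]
    exact ⟨hc, this⟩
  exact hp.isClosedMap

/-- local comparison -/
theorem graphF_local (x0 : E) (ι : W →ₗᵢ[ℝ] E) (ν0 : E) (hν : ‖ν0‖ = 1)
    (ho : ∀ w, ⟪ι w, ν0⟫ = 0) (g : W → ℝ) (hg : ContDiff ℝ 1 g) (x : W) (ε : ℝ) (hε : 0 < ε) :
    ∀ᶠ r in 𝓝[>] (0 : ℝ), ∀ w ∈ Metric.closedBall x r, ∀ w' ∈ Metric.closedBall x r,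
      |‖graphF x0 ι ν0 g w - graphF x0 ι ν0 g w'‖ - ‖stretch (gradient g x) w - stretch (gradient g x) w'‖|
        ≤ ε * ‖w - w'‖ := by
  have hs : HasStrictFDerivAt g (fderiv ℝ g x) x := hg.contDiffAt.hasStrictFDerivAt (by norm_num)
  have h2 := hs.isLittleO.def hε
  rw [nhds_prod_eq, Filter.eventually_prod_self_iff'] at h2
  obtain ⟨t, ht, h2⟩ := h2
  obtain ⟨δ, hδ, hδt⟩ := Metric.mem_nhds_iff.1 ht
  have hr : ∀ᶠ r in 𝓝[>] (0 : ℝ), r < δ := by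
    apply mem_nhdsWithin_of_mem_nhds
    exact Iio_mem_nhds hδ
  filter_upwards [hr] with r hr w hw w' hw'
  have h3 := h2 w (hδt (Metric.closedBall_subset_ball hr hw)) w'
    (hδt (Metric.closedBall_subset_ball hr hw'))
  simp only at h3
  refine le_trans ?_ h3
  have e1 := graphF_norm_sq x0 ι ν0 hν ho g w w'
  have e2 := stretch_norm_sq (gradient g x) (w - w')
  rw [map_sub] at e2
  have e3 : ⟪gradient g x, w - w'⟫ = fderiv ℝ g x (w - w') := by
    simp [gradient]
  rw [e3] at e2
  rw [Real.norm_eq_abs]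
  set A := ‖graphF x0 ι ν0 g w - graphF x0 ι ν0 g w'‖
  set B := ‖stretch (gradient g x) w - stretch (gradient g x) w'‖
  set s := g w - g w'
  set t := fderiv ℝ g x (w - w')
  have hA : 0 ≤ A := norm_nonneg _
  have hB : 0 ≤ B := norm_nonneg _
  rw [← sq_le_sq]
  have : ‖w - w'‖ ^ 2 + s * t ≤ A * B := by
    apply le_of_sq_le_sq _ (by positivity)
    rw [mul_pow, e1, e2]
    nlinarith [mul_nonneg (sq_nonneg ‖w - w'‖) (sq_nonneg (s - t))]
  nlinarith

theorem ennreal_limit_aux (R : ℝ → ℝ≥0∞) (l J : ℝ≥0∞) (d : ℕ) (hR : Tendsto R (𝓝[>] 0) (𝓝 l))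
    (h : ∀ ε : ℝ≥0, 0 < ε → ∀ᶠ r in 𝓝[>] (0 : ℝ), R r ≤ ((1 + ε : ℝ≥0) : ℝ≥0∞) ^ d * J ∧
      J ≤ ((1 + ε : ℝ≥0) : ℝ≥0∞) ^ d * R r) (hJ : J ≠ ⊤) : l = J := by
  have h1 : ∀ ε : ℝ≥0, 0 < ε → l ≤ ((1 + ε : ℝ≥0) : ℝ≥0∞) ^ d * J := fun ε hε =>
    le_of_tendsto hR ((h ε hε).mono fun r hr => hr.1)
  have hl : l ≠ ⊤ := by
    refine ne_top_of_le_ne_top ?_ (h1 1 one_pos)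
    finiteness
  have h2 : ∀ ε : ℝ≥0, 0 < ε → J ≤ ((1 + ε : ℝ≥0) : ℝ≥0∞) ^ d * l := fun ε hε =>
    ge_of_tendsto (ENNReal.Tendsto.const_mul hR (Or.inr (by finiteness)))
      ((h ε hε).mono fun r hr => hr.2)
  lift l to ℝ≥0 using hl
  lift J to ℝ≥0 using hJ
  have key : ∀ c : ℝ≥0, Tendsto (fun ε : ℝ≥0 => (1 + ε) ^ d * c) (𝓝[>] 0) (𝓝 c) := by
    intro c
    have : Continuous (fun ε : ℝ≥0 => (1 + ε) ^ d * c) := by fun_prop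
    have := this.tendsto 0
    simp only [add_zero, one_pow, one_mul] at this
    exact this.mono_left nhdsWithin_le_nhds
  have : (𝓝[>] (0 : ℝ≥0)).NeBot := inferInstance
  apply le_antisymm
  · norm_cast
    refine ge_of_tendsto (key J) ?_
    filter_upwards [self_mem_nhdsWithin] with ε hε
    exact_mod_cast h1 ε hε
  · norm_cast
    refine ge_of_tendsto (key l) ?_
    filter_upwards [self_mem_nhdsWithin] with ε hε
    exact_mod_cast h2 ε hε

theorem graphF_area (x0 : E) (ι : W →ₗᵢ[ℝ] E) (ν0 : E) (hν : ‖ν0‖ = 1)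
    (ho : ∀ w, ⟪ι w, ν0⟫ = 0) (g : W → ℝ) (hg : ContDiff ℝ 1 g) (C : ℝ≥0)
    (hC : LipschitzWith C g) :
    (μH[(finrank ℝ W : ℝ)] : Measure E).restrict (range (graphF x0 ι ν0 g)) =
      Measure.map (graphF x0 ι ν0 g) ((μH[(finrank ℝ W : ℝ)] : Measure W).withDensity
        (fun w => ENNReal.ofReal (areaJ (gradient g w)))) := by
  set F := graphF x0 ι ν0 g with hF
  have hemb : MeasurableEmbedding F :=
    (graphF_closedEmb x0 ι ν0 hν ho g hg.continuous).measurableEmbedding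
  have hlip : LipschitzWith (1 + C) F := graphF_lip x0 ι ν0 hν g C hC
  rw [← hemb.map_comap]
  congr 1
  set m := Measure.comap F (μH[(finrank ℝ W : ℝ)] : Measure E) with hm
  set μ := (μH[(finrank ℝ W : ℝ)] : Measure W) with hμ
  have hmA : ∀ A, m A = μH[(finrank ℝ W : ℝ)] (F '' A) := fun A => hemb.comap_apply _ _
  have hd : (0 : ℝ) ≤ finrank ℝ W := Nat.cast_nonneg _
  have hle : ∀ A, m A ≤ ((1 + C : ℝ≥0) : ℝ≥0∞) ^ (finrank ℝ W : ℝ) * μ A := fun A => by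
    rw [hmA]; exact hlip.hausdorffMeasure_image_le hd A
  have hac : m ≪ μ := by
    intro A hA
    have := hle A
    rw [hA, mul_zero] at this
    exact le_antisymm this zero_le
  have : IsLocallyFiniteMeasure m := by
    constructor
    intro x
    refine ⟨Metric.closedBall x 1, Metric.closedBall_mem_nhds x one_pos, ?_⟩
    refine (hle _).trans_lt ?_
    apply ENNReal.mul_lt_top
    · rw [ENNReal.rpow_natCast]; finiteness
    · exact (isCompact_closedBall x 1).measure_lt_top
  rw [← Measure.withDensity_rnDeriv_eq m μ hac]
  apply withDensity_congr_ae
  filter_upwards [Besicovitch.ae_tendsto_rnDeriv m μ] with x hx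
  refine ennreal_limit_aux _ _ _ (finrank ℝ W) hx ?_ ENNReal.ofReal_ne_top
  intro ε hε
  filter_upwards [graphF_local x0 ι ν0 hν ho g hg x ε (by exact_mod_cast hε), self_mem_nhdsWithin]
    with r hr hr0
  have hr0 : 0 < r := hr0
  have hμ0 : μ (Metric.closedBall x r) ≠ 0 := (Metric.measure_closedBall_pos μ x hr0).ne'
  have hμt : μ (Metric.closedBall x r) ≠ ⊤ := (isCompact_closedBall x r).measure_lt_top.ne
  set S := stretch (gradient g x) with hS
  have hexp : ∀ w w', ‖w - w'‖ ≤ ‖S w - S w'‖ := by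
    intro w w'
    have e2 := stretch_norm_sq (gradient g x) (w - w')
    rw [map_sub] at e2
    apply le_of_sq_le_sq _ (norm_nonneg _)
    rw [e2]; nlinarith [sq_nonneg ⟪gradient g x, w - w'⟫]
  have c1 := hmeas_compare S F (Metric.closedBall x r) (1 + ε) hd (by
    intro w hw w' hw'
    have h1 := hr w hw w' hw'
    have h2 := hexp w w'
    rw [abs_le] at h1
    rw [dist_eq_norm, dist_eq_norm]
    push_cast
    have : (ε : ℝ) * ‖w - w'‖ ≤ ε * ‖S w - S w'‖ := by gcongr
    linarith [h1.2])
  have c2 := hmeas_compare F S (Metric.closedBall x r) (1 + ε) hd (by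
    intro w hw w' hw'
    have h1 := hr w hw w' hw'
    have h2 := graphF_dist_le x0 ι ν0 hν ho g w w'
    rw [abs_le] at h1
    rw [dist_eq_norm, dist_eq_norm]
    push_cast
    have : (ε : ℝ) * ‖w - w'‖ ≤ ε * ‖F w - F w'‖ := by gcongr
    linarith [h1.1])
  rw [stretch_det_meas, ← hmA, ENNReal.rpow_natCast] at c1 c2
  constructor
  · rw [ENNReal.div_le_iff hμ0 hμt, mul_assoc]
    exact c1
  · rw [← mul_div_assoc, ENNReal.le_div_iff_mul_le (Or.inl hμ0) (Or.inl hμt)]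
    exact c2

end areaformula2

section ibp
open Measure Set Filter Topology Module
open scoped NNReal ENNReal

variable {W : Type*} [NormedAddCommGroup W] [InnerProductSpace ℝ W] [FiniteDimensional ℝ W]
  [MeasurableSpace W] [BorelSpace W] [CompleteSpace W]

theorem integral_fderiv_zero (μ : Measure W) [IsAddHaarMeasure μ] (h : W → ℝ) (hh : ContDiff ℝ 1 h)
    (hc : HasCompactSupport h) (v : W) :
    Integrable (fun w => fderiv ℝ h w v) μ ∧ ∫ w, fderiv ℝ h w v ∂μ = 0 := by
  have hint : Integrable (fun w => fderiv ℝ h w v) μ := by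
    apply Continuous.integrable_of_hasCompactSupport
    · have := hh.continuous_fderiv (by norm_num)
      fun_prop
    · exact (hc.fderiv (𝕜 := ℝ)).comp_left (g := fun L : W →L[ℝ] ℝ => L v) (by simp)
  refine ⟨hint, ?_⟩
  have := integral_mul_fderiv_eq_neg_fderiv_mul_of_integrable (μ := μ) (f := fun _ : W => (1 : ℝ))
    (g := h) (v := v) (by simp) (by simpa using hint)
    (by simpa using hh.continuous.integrable_of_hasCompactSupport hc)
    (fun x _ => by fun_prop) (fun x _ => (hh.differentiable (by norm_num)).differentiableAt)
  simpa using this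

theorem gradient_contDiff (g : W → ℝ) (hg : ContDiff ℝ 2 g) : ContDiff ℝ 1 (gradient g) := by
  have h1 : ContDiff ℝ 1 (fderiv ℝ g) := hg.fderiv_right (by norm_num)
  unfold gradient
  exact (InnerProductSpace.toDual ℝ W).symm.contDiff.comp h1

theorem areaJ_contDiff : ContDiff ℝ 1 (areaJ : W → ℝ) := by
  unfold areaJ
  apply ContDiff.sqrt
  · exact contDiff_const.add (contDiff_norm_sq ℝ)
  · intro x; positivity

theorem areaJ_fderiv (G : W → W) (w v : W) (hG : DifferentiableAt ℝ G w) :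
    fderiv ℝ (fun w => areaJ (G w)) w v = (areaJ (G w))⁻¹ * ⟪fderiv ℝ G w v, G w⟫ := by
  unfold areaJ
  have h1 : HasFDerivAt (fun w => 1 + ‖G w‖ ^ 2) (2 • (innerSL ℝ (G w)).comp (fderiv ℝ G w)) w :=
    (hG.hasFDerivAt.norm_sq).const_add 1
  have h2 := h1.sqrt (by positivity)
  rw [h2.fderiv]
  simp [real_inner_comm]
  ring

theorem gradient_symm (g : W → ℝ) (hg : ContDiff ℝ 2 g) (w v v' : W) :
    ⟪fderiv ℝ (gradient g) w v, v'⟫ = ⟪fderiv ℝ (gradient g) w v', v⟫ := by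
  have h1 : ContDiff ℝ 1 (fderiv ℝ g) := hg.fderiv_right (by norm_num)
  have hs : IsSymmSndFDerivAt ℝ g w := hg.contDiffAt.isSymmSndFDerivAt (by simp)
  have hd : DifferentiableAt ℝ (fderiv ℝ g) w := (h1.differentiable (by norm_num)).differentiableAt
  have key : ∀ a b : W, ⟪fderiv ℝ (gradient g) w a, b⟫ = fderiv ℝ (fderiv ℝ g) w a b := by
    intro a b
    have : fderiv ℝ (gradient g) w =
        ((InnerProductSpace.toDual ℝ W).symm.toContinuousLinearEquiv.toContinuousLinearMap).comp (fderiv ℝ (fderiv ℝ g) w) := by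
      unfold gradient
      exact ((InnerProductSpace.toDual ℝ W).symm.toContinuousLinearEquiv.toContinuousLinearMap.hasFDerivAt.comp w hd.hasFDerivAt).fderiv
    rw [this]
    simp
  rw [key, key]
  exact hs v v'

theorem graph_ibp {κ : Type*} [Fintype κ] (b : OrthonormalBasis κ ℝ W)
    (μ : Measure W) [IsAddHaarMeasure μ] (g : W → ℝ) (hg : ContDiff ℝ 2 g)
    (u : W → ℝ) (hu : ContDiff ℝ 1 u) (huc : HasCompactSupport u) (e : W) (c : ℝ)
    (Y : W → W) (hY : ∀ w, Y w = -((areaJ (gradient g w))⁻¹ • gradient g w)) :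
    Integrable (fun w => areaJ (gradient g w) * fderiv ℝ u w e - (c - ⟪gradient g w, e⟫) *
      (fderiv ℝ u w (Y w) + u w * ∑ j, ⟪b j, fderiv ℝ Y w (b j)⟫)) μ ∧
    ∫ w, (areaJ (gradient g w) * fderiv ℝ u w e - (c - ⟪gradient g w, e⟫) *
      (fderiv ℝ u w (Y w) + u w * ∑ j, ⟪b j, fderiv ℝ Y w (b j)⟫)) ∂μ = 0 := by
  set G := gradient g with hGdef
  have hG : ContDiff ℝ 1 G := gradient_contDiff g hg
  have hJ : ContDiff ℝ 1 (fun w => areaJ (G w)) := areaJ_contDiff.comp hG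
  have hJ0 : ∀ w, areaJ (G w) ≠ 0 := fun w => (lt_of_lt_of_le one_pos (areaJ_one_le (G w))).ne'
  have hYc : ContDiff ℝ 1 Y := by
    have : Y = fun w => -((areaJ (G w))⁻¹ • G w) := funext hY
    rw [this]
    exact ((hJ.inv hJ0).smul hG).neg
  have hk : ContDiff ℝ 1 (fun w => c - ⟪G w, e⟫) := contDiff_const.sub (hG.inner ℝ contDiff_const)
  have hYj : ∀ j, ContDiff ℝ 1 (fun w => ⟪b j, Y w⟫) := fun j => contDiff_const.inner ℝ hYc
  have A := integral_fderiv_zero μ (fun w => areaJ (G w) * u w) (hJ.mul hu) huc.mul_left e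
  have B := fun j => integral_fderiv_zero μ (fun w => (c - ⟪G w, e⟫) * (⟪b j, Y w⟫ * u w))
    (hk.mul ((hYj j).mul hu)) (huc.mul_left.mul_left) (b j)
  have hpt : ∀ w, areaJ (G w) * fderiv ℝ u w e - (c - ⟪G w, e⟫) *
      (fderiv ℝ u w (Y w) + u w * ∑ j, ⟪b j, fderiv ℝ Y w (b j)⟫) =
      fderiv ℝ (fun w => areaJ (G w) * u w) w e -
        ∑ j, fderiv ℝ (fun w => (c - ⟪G w, e⟫) * (⟪b j, Y w⟫ * u w)) w (b j) := by
    intro w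
    have dG : DifferentiableAt ℝ G w := (hG.differentiable (by norm_num)).differentiableAt
    have du : DifferentiableAt ℝ u w := (hu.differentiable (by norm_num)).differentiableAt
    have dJ : DifferentiableAt ℝ (fun w => areaJ (G w)) w := (hJ.differentiable (by norm_num)).differentiableAt
    have dY : DifferentiableAt ℝ Y w := (hYc.differentiable (by norm_num)).differentiableAt
    have dk : DifferentiableAt ℝ (fun w => c - ⟪G w, e⟫) w := (hk.differentiable (by norm_num)).differentiableAt
    have dYj := fun j => ((hYj j).differentiable (by norm_num)).differentiableAt (x := w)
    have e1 : fderiv ℝ (fun w => areaJ (G w) * u w) w e =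
        areaJ (G w) * fderiv ℝ u w e + u w * ((areaJ (G w))⁻¹ * ⟪fderiv ℝ G w e, G w⟫) := by
      rw [fderiv_fun_mul dJ du]
      simp [areaJ_fderiv G w e dG]
    have e2 : ∀ j, fderiv ℝ (fun w => (c - ⟪G w, e⟫) * (⟪b j, Y w⟫ * u w)) w (b j) =
        (c - ⟪G w, e⟫) * (⟪b j, Y w⟫ * fderiv ℝ u w (b j) + u w * ⟪b j, fderiv ℝ Y w (b j)⟫)
          - (⟪b j, Y w⟫ * u w) * ⟪fderiv ℝ G w (b j), e⟫ := by
      intro j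
      rw [fderiv_fun_mul dk ((dYj j).fun_mul du), fderiv_fun_mul (dYj j) du, fderiv_const_sub]
      simp [fderiv_inner_apply ℝ dG (differentiableAt_const e),
        fderiv_inner_apply ℝ (differentiableAt_const (b j)) dY]
      ring
    have e3 : ∀ L : W →L[ℝ] ℝ, L (Y w) = ∑ j, ⟪b j, Y w⟫ * L (b j) := by
      intro L
      conv_lhs => rw [← b.sum_repr' (Y w)]
      simp
    have e4 : ⟪fderiv ℝ G w (Y w), e⟫ = ∑ j, ⟪b j, Y w⟫ * ⟪fderiv ℝ G w (b j), e⟫ := by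
      have := e3 ((innerSL ℝ e).comp (fderiv ℝ G w))
      simpa [real_inner_comm] using this
    have e5 : ⟪fderiv ℝ G w (Y w), e⟫ = - ((areaJ (G w))⁻¹ * ⟪fderiv ℝ G w e, G w⟫) := by
      rw [hGdef, gradient_symm g hg, hY w, inner_neg_right, inner_smul_right]
    rw [e1, e3 (fderiv ℝ u w)]
    simp_rw [e2]
    have e6 : ∑ j, (⟪b j, Y w⟫ * u w) * ⟪fderiv ℝ G w (b j), e⟫ = u w * ⟪fderiv ℝ G w (Y w), e⟫ := by
      rw [e4, Finset.mul_sum]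
      exact Finset.sum_congr rfl fun j _ => by ring
    rw [Finset.sum_sub_distrib, e6, e5, ← Finset.mul_sum, Finset.sum_add_distrib, ← Finset.mul_sum]
    ring
  simp_rw [hpt]
  constructor
  · exact A.1.sub (integrable_finsetSum _ fun j _ => (B j).1)
  · rw [integral_sub A.1 (integrable_finsetSum _ fun j _ => (B j).1), A.2,
      integral_finsetSum _ fun j _ => (B j).1]
    simp [fun j => (B j).2]

end ibp

section chart
open Measure Set Filter Topology Module
open scoped NNReal ENNReal

abbrev Wn (n : ℕ) := EuclideanSpace ℝ (Fin n)

/-- graph chart -/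
structure HChart (M : Hypersurface n) (x0 : Eu n) where
  ι : Wn n →ₗᵢ[ℝ] Eu n
  g : Wn n → ℝ
  C : ℝ≥0
  V : Set (Eu n)
  ho : ∀ w, ⟪ι w, M.nu x0⟫ = 0
  hg : ContDiff ℝ 2 g
  hC : LipschitzWith C g
  hV : IsOpen V
  hx0 : x0 ∈ V
  hb : Bornology.IsBounded V
  hMV : M.carrier ∩ V = range (graphF x0 ι (M.nu x0) g) ∩ V
  hnu : ∀ w, graphF x0 ι (M.nu x0) g w ∈ V → M.nu (graphF x0 ι (M.nu x0) g w) =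
    (areaJ (gradient g w))⁻¹ • (M.nu x0 - ι (gradient g w))

theorem exists_iota (ν0 : Eu n) (hν : ‖ν0‖ = 1) : ∃ ι : Wn n →ₗᵢ[ℝ] Eu n,
    ∀ w, ⟪ι w, ν0⟫ = 0 := by
  have : Fact (finrank ℝ (Eu n) = n + 1) := ⟨by simp⟩
  have h0 : ν0 ≠ 0 := by rintro rfl; simp at hν
  let b := OrthonormalBasis.fromOrthogonalSpanSingleton n (𝕜 := ℝ) h0
  refine ⟨(Submodule.subtypeₗᵢ _).comp b.repr.symm.toLinearIsometry, fun w => ?_⟩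
  have := (b.repr.symm w).2
  rw [Submodule.mem_orthogonal_singleton_iff_inner_left] at this
  exact this

/-- the projection -/
def proj (ι : Wn n →ₗᵢ[ℝ] Eu n) : Eu n →L[ℝ] Wn n := ContinuousLinearMap.adjoint ι.toContinuousLinearMap

theorem inner_proj (ι : Wn n →ₗᵢ[ℝ] Eu n) (w : Wn n) (y : Eu n) : ⟪w, proj ι y⟫ = ⟪ι w, y⟫ := by
  simp [proj, ContinuousLinearMap.adjoint_inner_right]

theorem proj_inner (ι : Wn n →ₗᵢ[ℝ] Eu n) (w : Wn n) (y : Eu n) : ⟪proj ι y, w⟫ = ⟪y, ι w⟫ := by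
  simp [proj, ContinuousLinearMap.adjoint_inner_left]

theorem proj_iota (ι : Wn n →ₗᵢ[ℝ] Eu n) (w : Wn n) : proj ι (ι w) = w := by
  apply ext_inner_left ℝ
  intro v
  rw [inner_proj, ι.inner_map_map]

theorem proj_nu (ι : Wn n →ₗᵢ[ℝ] Eu n) (ν0 : Eu n) (ho : ∀ w, ⟪ι w, ν0⟫ = 0) : proj ι ν0 = 0 := by
  apply ext_inner_left ℝ
  intro v
  rw [inner_proj, ho, inner_zero_right]

theorem decomp (ι : Wn n →ₗᵢ[ℝ] Eu n) (ν0 : Eu n) (hν : ‖ν0‖ = 1) (ho : ∀ w, ⟪ι w, ν0⟫ = 0)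
    (y : Eu n) : y = ι (proj ι y) + ⟪ν0, y⟫ • ν0 := by
  have hF : Fact (finrank ℝ (Eu n) = n + 1) := ⟨by simp⟩
  have h0 : ν0 ≠ 0 := by rintro rfl; simp at hν
  have hle : LinearMap.range ι.toLinearMap ≤ (ℝ ∙ ν0)ᗮ := by
    rintro _ ⟨w, rfl⟩
    rw [Submodule.mem_orthogonal_singleton_iff_inner_left]
    exact ho w
  have heq : LinearMap.range ι.toLinearMap = (ℝ ∙ ν0)ᗮ := by
    apply Submodule.eq_of_le_of_finrank_eq hle
    rw [LinearMap.finrank_range_of_inj ι.injective, Submodule.finrank_orthogonal_span_singleton (n := n) h0]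
    simp
  have hz : y - ⟪ν0, y⟫ • ν0 ∈ (ℝ ∙ ν0)ᗮ := by
    rw [Submodule.mem_orthogonal_singleton_iff_inner_right, inner_sub_right, inner_smul_right,
      real_inner_self_eq_norm_sq, hν]
    ring
  rw [← heq] at hz
  obtain ⟨w, hw⟩ := hz
  have hw : ι w = y - ⟪ν0, y⟫ • ν0 := hw
  have : proj ι y = w := by
    have h2 : y = ι w + ⟪ν0, y⟫ • ν0 := by rw [hw]; abel
    conv_lhs => rw [h2]
    rw [map_add, map_smul, proj_iota, proj_nu ι ν0 ho]; simp
  rw [this, hw]; abel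

theorem graphF_hasFDerivAt (x0 : Eu n) (ι : Wn n →ₗᵢ[ℝ] Eu n) (ν0 : Eu n) (g : Wn n → ℝ) (w : Wn n)
    (hg : DifferentiableAt ℝ g w) :
    HasFDerivAt (graphF x0 ι ν0 g) (ι.toContinuousLinearMap + (fderiv ℝ g w).smulRight ν0) w := by
  unfold graphF
  exact (ι.toContinuousLinearMap.hasFDerivAt.const_add x0).add (hg.hasFDerivAt.smul_const ν0)

theorem graphF_proj (x0 : Eu n) (ι : Wn n →ₗᵢ[ℝ] Eu n) (ν0 : Eu n) (ho : ∀ w, ⟪ι w, ν0⟫ = 0)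
    (g : Wn n → ℝ) (w : Wn n) : proj ι (graphF x0 ι ν0 g w - x0) = w := by
  unfold graphF
  rw [show x0 + ι w + g w • ν0 - x0 = ι w + g w • ν0 by abel, map_add, map_smul, proj_iota,
    proj_nu ι ν0 ho]; simp

/-- the derivative equivalence -/
def dEquiv (ι : Wn n →ₗᵢ[ℝ] Eu n) (ν0 : Eu n) (hν : ‖ν0‖ = 1) (ho : ∀ w, ⟪ι w, ν0⟫ = 0)
    (l : ℝ) (hl : l ≠ 0) : Eu n ≃L[ℝ] (Wn n × ℝ) :=
  ContinuousLinearEquiv.equivOfInverse ((proj ι).prod (l • innerSL ℝ ν0))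
    (ι.toContinuousLinearMap.coprod ((1 : ℝ →L[ℝ] ℝ).smulRight (l⁻¹ • ν0)))
    (by
      intro y
      conv_rhs => rw [decomp ι ν0 hν ho y]
      simp [smul_smul]
      congr 1
      field_simp)
    (by
      rintro ⟨w, t⟩
      have h1 : ⟪ν0, ι w⟫ = 0 := by rw [real_inner_comm]; exact ho w
      simp [proj_iota, proj_nu ι ν0 ho, inner_add_right, inner_smul_right, h1,
        hν]
      field_simp)

end chart

section chart2
open Measure Set Filter Topology Module
open scoped NNReal ENNReal

theorem implicit_graph (x0 : Eu n) (ι : Wn n →ₗᵢ[ℝ] Eu n) (ν0 : Eu n) (hν : ‖ν0‖ = 1)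
    (ho : ∀ w, ⟪ι w, ν0⟫ = 0) (f : Eu n → ℝ) (hf : ContDiff ℝ 2 f) (hf0 : f x0 = 0)
    (l : ℝ) (hl : l ≠ 0) (hfd : fderiv ℝ f x0 = l • innerSL ℝ ν0) :
    ∃ (g : Wn n → ℝ) (C : ℝ≥0) (δ : ℝ) (S : Set (Eu n)), ContDiff ℝ 2 g ∧ LipschitzWith C g ∧
      0 < δ ∧ IsOpen S ∧ x0 ∈ S ∧ (∀ w, ‖w‖ < δ → f (graphF x0 ι ν0 g w) = 0) ∧
      (∀ y ∈ S, f y = 0 → ‖proj ι (y - x0)‖ < δ → y = graphF x0 ι ν0 g (proj ι (y - x0))) := by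
  let Φ : Eu n → Wn n × ℝ := fun y => (proj ι (y - x0), f y)
  have hΦ : ContDiffAt ℝ 2 Φ x0 := by
    apply ContDiff.contDiffAt
    exact ((proj ι).contDiff.comp (contDiff_id.sub contDiff_const)).prodMk hf
  have hΦ' : HasFDerivAt Φ (dEquiv ι ν0 hν ho l hl : Eu n →L[ℝ] (Wn n × ℝ)) x0 := by
    have h1 : HasFDerivAt (fun y => proj ι (y - x0)) (proj ι) x0 := by
      have := (proj ι).hasFDerivAt.comp x0 ((hasFDerivAt_id x0).sub_const x0)
      rw [ContinuousLinearMap.comp_id] at this; exact this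
    have h2 : HasFDerivAt f (l • innerSL ℝ ν0) x0 := by
      rw [← hfd]; exact (hf.differentiable (by norm_num)).differentiableAt.hasFDerivAt
    exact h1.prodMk h2
  let e := hΦ.toOpenPartialHomeomorph Φ hΦ' (by norm_num)
  have he : ∀ y, e y = Φ y := fun y => rfl
  have hes : x0 ∈ e.source := hΦ.mem_toOpenPartialHomeomorph_source hΦ' (by norm_num)
  have hΦ0 : Φ x0 = (0, 0) := by simp [Φ, hf0]
  have het : ((0 : Wn n), (0 : ℝ)) ∈ e.target := by
    rw [← hΦ0]; exact hΦ.image_mem_toOpenPartialHomeomorph_target hΦ' (by norm_num)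
  have hinv : ContDiffAt ℝ 2 e.symm (0, 0) := by
    rw [← hΦ0]; exact hΦ.to_localInverse hΦ' (by norm_num)
  let g0 : Wn n → ℝ := fun w => ⟪ν0, e.symm (w, 0) - x0⟫
  have hg0 : ContDiffAt ℝ 2 g0 0 := by
    have h1 : ContDiffAt ℝ 2 (fun w : Wn n => e.symm (w, 0)) 0 :=
      ContDiffAt.comp (g := e.symm) (f := fun w : Wn n => (w, (0 : ℝ))) 0 hinv
        (contDiffAt_id.prodMk contDiffAt_const)
    exact contDiffAt_const.inner ℝ (h1.sub contDiffAt_const)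
  have hev : ∀ᶠ w in 𝓝 (0 : Wn n), ContDiffAt ℝ 2 g0 w ∧ (w, (0 : ℝ)) ∈ e.target := by
    refine (hg0.eventually (by norm_num)).and ?_
    have hc : ContinuousAt (fun w : Wn n => (w, (0 : ℝ))) 0 := by fun_prop
    exact hc.preimage_mem_nhds (e.open_target.mem_nhds het)
  obtain ⟨δ, hδ, hball⟩ := Metric.eventually_nhds_iff_ball.1 hev
  let B : ContDiffBump (0 : Wn n) := ⟨δ / 3, δ / 2, by positivity, by linarith⟩
  let g : Wn n → ℝ := fun w => B w * g0 w
  have hgc : HasCompactSupport g := B.hasCompactSupport.mul_right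
  have hg : ContDiff ℝ 2 g := by
    rw [contDiff_iff_contDiffAt]
    intro w
    by_cases hw : w ∈ Metric.ball (0 : Wn n) δ
    · exact B.contDiffAt.mul (hball w hw).1
    · have hw' : w ∉ tsupport B := by
        rw [B.tsupport_eq]
        intro h
        apply hw
        exact Metric.closedBall_subset_ball (by simp [B]; linarith) h
      have h2 : g =ᶠ[𝓝 w] fun _ => 0 := by
        have := notMem_tsupport_iff_eventuallyEq.1 hw'
        filter_upwards [this] with z hz
        simp [g, hz]
      exact contDiffAt_const.congr_of_eventuallyEq h2
  obtain ⟨C, hC⟩ := ContDiff.lipschitzWith_of_hasCompactSupport (𝕂 := ℝ) hgc hg (by norm_num)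
  have hsymm : ∀ w, ‖w‖ < δ / 3 → graphF x0 ι ν0 g w = e.symm (w, 0) := by
    intro w hw
    have hwt : (w, (0 : ℝ)) ∈ e.target := (hball w (by simp; linarith)).2
    have h1 : Φ (e.symm (w, 0)) = (w, 0) := by rw [← he]; exact e.right_inv hwt
    have h2 : proj ι (e.symm (w, 0) - x0) = w := congrArg Prod.fst h1
    have h3 : g w = g0 w := by
      simp only [g]
      rw [B.one_of_mem_closedBall (by simp [B]; linarith), one_mul]
    have h4 := decomp ι ν0 hν ho (e.symm (w, 0) - x0)
    rw [h2] at h4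
    unfold graphF
    rw [h3, add_assoc, ← h4]
    abel
  refine ⟨g, C, δ / 3, e.source, hg, hC, by positivity, e.open_source, hes, ?_, ?_⟩
  · intro w hw
    have hwt : (w, (0 : ℝ)) ∈ e.target := (hball w (by simp; linarith)).2
    have h1 : Φ (e.symm (w, 0)) = (w, 0) := by rw [← he]; exact e.right_inv hwt
    rw [hsymm w hw]
    exact congrArg Prod.snd h1
  · intro y hy hfy hw
    rw [hsymm _ hw, ← hfy]
    exact (e.left_inv hy).symm

theorem exists_chart (M : Hypersurface n) (x0 : Eu n) (hx0 : x0 ∈ M.carrier) :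
    Nonempty (HChart M x0) := by
  obtain ⟨U, hU, hxU, f, hf, hMU, hgr, hnu⟩ := M.locally_level_set x0 hx0
  have hν : ‖M.nu x0‖ = 1 := M.unit_nu x0 hx0
  obtain ⟨ι, ho⟩ := exists_iota (M.nu x0) hν
  have hf2 : ContDiff ℝ 2 f := contDiff_infty.1 hf 2
  have hfdiff : Differentiable ℝ f := hf2.differentiable (by norm_num)
  have hf0 : f x0 = 0 := by
    have : x0 ∈ M.carrier ∩ U := ⟨hx0, hxU⟩
    rw [hMU] at this; exact this.2
  have hl : ‖gradient f x0‖ ≠ 0 := norm_ne_zero_iff.2 (hgr x0 hxU)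
  have hinner : ∀ x v, fderiv ℝ f x v = ⟪gradient f x, v⟫ := fun x v => by simp [gradient]
  have hfd : fderiv ℝ f x0 = ‖gradient f x0‖ • innerSL ℝ (M.nu x0) := by
    ext v
    rw [hinner, hnu x0 ⟨hx0, hxU⟩]
    simp [inner_smul_left]
    field_simp
  obtain ⟨g, C, δ, S, hg, hC, hδ, hS, hxS, ha, hb⟩ :=
    implicit_graph x0 ι (M.nu x0) hν ho f hf2 hf0 _ hl hfd
  have hnuc : Continuous M.nu := M.smooth_nu.continuous
  let V : Set (Eu n) := S ∩ U ∩ {y | ‖proj ι (y - x0)‖ < δ} ∩ Metric.ball x0 1 ∩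
    {y | 0 < ⟪M.nu x0, M.nu y⟫}
  have hMV : M.carrier ∩ V = range (graphF x0 ι (M.nu x0) g) ∩ V := by
    ext y
    constructor
    · rintro ⟨hyM, hyV⟩
      refine ⟨?_, hyV⟩
      obtain ⟨⟨⟨⟨hyS, hyU⟩, hyδ⟩, _⟩, _⟩ := hyV
      have : y ∈ M.carrier ∩ U := ⟨hyM, hyU⟩
      rw [hMU] at this
      exact ⟨_, (hb y hyS this.2 hyδ).symm⟩
    · rintro ⟨⟨w, rfl⟩, hyV⟩
      refine ⟨?_, hyV⟩
      obtain ⟨⟨⟨⟨hyS, hyU⟩, hyδ⟩, _⟩, _⟩ := hyV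
      simp only [mem_setOf_eq, graphF_proj x0 ι (M.nu x0) ho] at hyδ
      have : graphF x0 ι (M.nu x0) g w ∈ {y ∈ U | f y = 0} := ⟨hyU, ha w hyδ⟩
      rw [← hMU] at this
      exact this.1
  refine ⟨⟨ι, g, C, V, ho, hg, hC, ?_, ?_, ?_, hMV, ?_⟩⟩
  · refine (((hS.inter hU).inter ?_).inter Metric.isOpen_ball).inter ?_
    · exact isOpen_lt (by fun_prop) continuous_const
    · exact isOpen_lt continuous_const (by fun_prop)
  · refine ⟨⟨⟨⟨hxS, hxU⟩, ?_⟩, ?_⟩, ?_⟩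
    · simpa using hδ
    · simp
    · simp [hν]
  · exact Metric.isBounded_ball.subset fun y hy => hy.1.2
  · intro w hw
    have hFM : graphF x0 ι (M.nu x0) g w ∈ M.carrier :=
      (hMV ▸ (⟨⟨w, rfl⟩, hw⟩ : _ ∈ range (graphF x0 ι (M.nu x0) g) ∩ V) : _ ∈ M.carrier ∩ V).1
    obtain ⟨⟨⟨⟨hyS, hyU⟩, hyδ⟩, _⟩, hpos⟩ := hw
    simp only [mem_setOf_eq, graphF_proj x0 ι (M.nu x0) ho] at hyδ hpos
    set y := graphF x0 ι (M.nu x0) g w with hy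
    have hgd : DifferentiableAt ℝ g w := (hg.differentiable (by norm_num)).differentiableAt
    have hF := graphF_hasFDerivAt x0 ι (M.nu x0) g w hgd
    have hcomp := (hfdiff (graphF x0 ι (M.nu x0) g w)).hasFDerivAt.comp w hF
    have hz : (f ∘ graphF x0 ι (M.nu x0) g) =ᶠ[𝓝 w] fun _ => (0 : ℝ) := by
      have : {w : Wn n | ‖w‖ < δ} ∈ 𝓝 w := (isOpen_lt continuous_norm continuous_const).mem_nhds hyδ
      filter_upwards [this] with z hz using ha z hz
    have hzero := hcomp.unique ((hasFDerivAt_const (0 : ℝ) w).congr_of_eventuallyEq hz)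
    have key : ∀ v, ⟪M.nu y, ι v⟫ + ⟪gradient g w, v⟫ * ⟪M.nu y, M.nu x0⟫ = 0 := by
      intro v
      have h1 := DFunLike.congr_fun hzero v
      have h2 : ⟪gradient g w, v⟫ = fderiv ℝ g w v := by simp [gradient]
      simp only [ContinuousLinearMap.comp_apply, hinner, ContinuousLinearMap.zero_apply,
        ContinuousLinearMap.add_apply, ContinuousLinearMap.smulRight_apply, inner_add_right,
        inner_smul_right, LinearIsometry.coe_toContinuousLinearMap] at h1
      rw [hnu y ⟨hFM, hyU⟩, h2]
      simp only [inner_smul_left, RCLike.conj_to_real]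
      rw [← hy] at h1
      linear_combination ‖gradient f y‖⁻¹ * h1
    set a := ⟪M.nu x0, M.nu y⟫ with hadef
    have hP : proj ι (M.nu y) = -(a • gradient g w) := by
      apply ext_inner_right ℝ
      intro v
      rw [proj_inner, inner_neg_left, inner_smul_left]
      have := key v
      rw [real_inner_comm (M.nu x0) (M.nu y), ← hadef] at this
      simp only [RCLike.conj_to_real]
      linarith
    have hdec := decomp ι (M.nu x0) hν ho (M.nu y)
    rw [hP, ← hadef] at hdec
    have hdec2 : M.nu y = a • (M.nu x0 - ι (gradient g w)) := by
      rw [hdec, map_neg, map_smul, smul_sub]; abel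
    have hn1 : ‖M.nu y‖ = 1 := M.unit_nu y hFM
    have hn2 : ‖M.nu x0 - ι (gradient g w)‖ ^ 2 = areaJ (gradient g w) ^ 2 := by
      rw [areaJ_sq, norm_sub_sq_real, hν, ι.norm_map, real_inner_comm, ho]; ring
    have hJ1 := areaJ_one_le (gradient g w)
    have hn3 : ‖M.nu x0 - ι (gradient g w)‖ = areaJ (gradient g w) := by
      rw [sq_eq_sq₀ (norm_nonneg _) (by linarith)] at hn2; exact hn2
    rw [hdec2, norm_smul, hn3, Real.norm_eq_abs, abs_of_pos hpos] at hn1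
    rw [hdec2, eq_inv_of_mul_eq_one_left hn1]

end chart2

section ident
open Measure Set Filter Topology Module
open scoped NNReal ENNReal

variable {M : Hypersurface n} {x0 : Eu n}

/-- chart map -/
def HChart.F (c : HChart M x0) : Wn n → Eu n := graphF x0 c.ι (M.nu x0) c.g

/-- projected normal -/
def HChart.Y (c : HChart M x0) : Wn n → Wn n :=
  fun w => -((areaJ (gradient c.g w))⁻¹ • gradient c.g w)

/-- derivative of chart -/
def HChart.D (c : HChart M x0) (w : Wn n) : Wn n →L[ℝ] Eu n :=
  c.ι.toContinuousLinearMap + (fderiv ℝ c.g w).smulRight (M.nu x0)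

theorem HChart.hasF (c : HChart M x0) (w : Wn n) : HasFDerivAt c.F (c.D w) w :=
  graphF_hasFDerivAt x0 c.ι (M.nu x0) c.g w (c.hg.differentiable (by norm_num)).differentiableAt

theorem HChart.contF (c : HChart M x0) : Continuous c.F :=
  continuous_iff_continuousAt.2 fun w => (c.hasF w).continuousAt

theorem HChart.D_apply (c : HChart M x0) (w v : Wn n) :
    c.D w v = c.ι v + ⟪gradient c.g w, v⟫ • M.nu x0 := by
  have : fderiv ℝ c.g w v = ⟪gradient c.g w, v⟫ := by
    rw [gradient]; simp
  show c.ι v + fderiv ℝ c.g w v • M.nu x0 = _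
  rw [this]

theorem HChart.mem (c : HChart M x0) (w : Wn n) (hw : c.F w ∈ c.V) : c.F w ∈ M.carrier := by
  have : c.F w ∈ M.carrier ∩ c.V := by rw [c.hMV]; exact ⟨mem_range_self w, hw⟩
  exact this.1

theorem HChart.Jnu (c : HChart M x0) (w : Wn n) (hw : c.F w ∈ c.V) :
    areaJ (gradient c.g w) • M.nu (c.F w) = M.nu x0 - c.ι (gradient c.g w) := by
  have hJ := (lt_of_lt_of_le one_pos (areaJ_one_le (gradient c.g w))).ne'
  have := c.hnu w hw
  rw [HChart.F, this, smul_smul, mul_inv_cancel₀ hJ, one_smul]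

theorem HChart.D_proj (c : HChart M x0) (hx0 : x0 ∈ M.carrier) (w : Wn n) (hw : c.F w ∈ c.V)
    (z : Eu n) (hz : ⟪z, M.nu (c.F w)⟫ = 0) : c.D w (proj c.ι z) = z := by
  have h1 : ⟪M.nu x0, z⟫ = ⟪gradient c.g w, proj c.ι z⟫ := by
    have h2 : ⟪z, areaJ (gradient c.g w) • M.nu (c.F w)⟫ = 0 := by
      rw [inner_smul_right, hz, mul_zero]
    rw [c.Jnu w hw, inner_sub_right, sub_eq_zero] at h2
    rw [inner_proj, real_inner_comm, h2, real_inner_comm]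
  rw [c.D_apply, ← h1, ← decomp c.ι _ (M.unit_nu x0 hx0) c.ho]

theorem HChart.proj_nu (c : HChart M x0) (w : Wn n) (hw : c.F w ∈ c.V) :
    proj c.ι (M.nu (c.F w)) = c.Y w := by
  have := c.hnu w hw
  rw [HChart.F, this, map_smul, map_sub, _root_.proj_nu c.ι _ c.ho, proj_iota]
  simp [HChart.Y]

theorem inner_gradient {H : Type*} [NormedAddCommGroup H] [InnerProductSpace ℝ H] [CompleteSpace H]
    (f : H → ℝ) (x v : H) : ⟪gradient f x, v⟫ = fderiv ℝ f x v := by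
  rw [gradient]; simp

theorem inner_tgrad (ν : Eu n → Eu n) (ψ : Eu n → ℝ) (x e : Eu n) :
    ⟪e, tgrad ν ψ x⟫ = fderiv ℝ ψ x (e - ⟪e, ν x⟫ • ν x) := by
  rw [tgrad, inner_sub_right, inner_smul_right, real_inner_comm, inner_gradient, inner_gradient,
    map_sub, map_smul, smul_eq_mul]
  ring

theorem HChart.tgrad_eq (c : HChart M x0) (hx0 : x0 ∈ M.carrier) (w : Wn n) (hw : c.F w ∈ c.V)
    (ψ : Eu n → ℝ) (hψ : DifferentiableAt ℝ ψ (c.F w)) (e : Eu n) :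
    ⟪e, tgrad M.nu ψ (c.F w)⟫ =
      fderiv ℝ (ψ ∘ c.F) w (proj c.ι e - ⟪e, M.nu (c.F w)⟫ • c.Y w) := by
  rw [inner_tgrad, (hψ.hasFDerivAt.comp w (c.hasF w)).fderiv, ContinuousLinearMap.comp_apply,
    ← c.proj_nu w hw, ← map_smul, ← map_sub, c.D_proj hx0 w hw]
  rw [inner_sub_left, inner_smul_left, real_inner_self_eq_norm_sq, M.unit_nu _ (c.mem w hw)]
  simp

theorem HChart.near (c : HChart M x0) (w : Wn n) (hw : c.F w ∈ c.V) :
    ∀ᶠ v in 𝓝 w, c.F v ∈ c.V :=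
  c.contF.continuousAt.preimage_mem_nhds (c.hV.mem_nhds hw)

theorem HChart.nuF (c : HChart M x0) (w : Wn n) :
    HasFDerivAt (fun v => M.nu (c.F v)) ((fderiv ℝ M.nu (c.F w)).comp (c.D w)) w :=
  ((M.smooth_nu.differentiable (by norm_num)).differentiableAt.hasFDerivAt).comp w (c.hasF w)

theorem HChart.fderivY (c : HChart M x0) (w : Wn n) (hw : c.F w ∈ c.V) :
    fderiv ℝ c.Y w = (proj c.ι).comp ((fderiv ℝ M.nu (c.F w)).comp (c.D w)) := by
  have h1 : HasFDerivAt (fun v => proj c.ι (M.nu (c.F v)))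
      ((proj c.ι).comp ((fderiv ℝ M.nu (c.F w)).comp (c.D w))) w :=
    (proj c.ι).hasFDerivAt.comp w (c.nuF w)
  refine (h1.congr_of_eventuallyEq ?_).fderiv
  filter_upwards [c.near w hw] with v hv
  exact (c.proj_nu v hv).symm

theorem HChart.nu_orth (c : HChart M x0) (w : Wn n) (hw : c.F w ∈ c.V) (v : Wn n) :
    ⟪M.nu (c.F w), fderiv ℝ M.nu (c.F w) (c.D w v)⟫ = 0 := by
  have h1 := (c.nuF w).norm_sq
  have h2 : HasFDerivAt (fun v => ‖M.nu (c.F v)‖ ^ 2) (0 : Wn n →L[ℝ] ℝ) w := by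
    refine (hasFDerivAt_const (1:ℝ) w).congr_of_eventuallyEq ?_
    filter_upwards [c.near w hw] with v hv
    rw [M.unit_nu _ (c.mem v hv)]; norm_num
  have h3 := congrArg (fun L => L v) (h1.unique h2)
  simpa using h3

theorem meanCurv_eq (M : Hypersurface n) (x : Eu n) :
    meanCurv M x = LinearMap.trace ℝ (Eu n) (fderiv ℝ M.nu x : Eu n →ₗ[ℝ] Eu n)
      - ⟪M.nu x, fderiv ℝ M.nu x (M.nu x)⟫ := by
  have hd : DifferentiableAt ℝ M.nu x := (M.smooth_nu.differentiable (by norm_num)).differentiableAt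
  have h1 : ∀ i v, fderiv ℝ (fun y => M.nu y i) x v = fderiv ℝ M.nu x v i := by
    intro i v
    have := ((EuclideanSpace.proj (𝕜 := ℝ) i).hasFDerivAt.comp x hd.hasFDerivAt).fderiv
    exact congrArg (fun L => L v) this
  have h2 : M.nu x = ∑ j, M.nu x j • EuclideanSpace.single j (1:ℝ) := by
    ext k
    simp [Pi.single_apply]
  rw [LinearMap.trace_eq_sum_inner _ (EuclideanSpace.basisFun (Fin (n+1)) ℝ), meanCurv, tdiv]
  simp only [tderiv, h1, Finset.sum_sub_distrib]
  congr 1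
  · refine Finset.sum_congr rfl fun i _ => ?_
    simp only [EuclideanSpace.basisFun_apply, EuclideanSpace.inner_single_left]
    simp
  · rw [PiLp.inner_apply]
    refine Finset.sum_congr rfl fun i _ => ?_
    conv_rhs => rw [show fderiv ℝ M.nu x (M.nu x) =
      ∑ j, M.nu x j • fderiv ℝ M.nu x (EuclideanSpace.single j (1:ℝ)) by
        conv_lhs => rw [h2]
        simp only [_root_.map_sum, map_smul]]
    simp [Finset.mul_sum, Finset.sum_mul]
    refine Finset.sum_congr rfl fun j _ => by ring

theorem HChart.meanCurv_eq (c : HChart M x0) (hx0 : x0 ∈ M.carrier) (w : Wn n) (hw : c.F w ∈ c.V)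
    {κ : Type*} [Fintype κ] (b : OrthonormalBasis κ ℝ (Wn n)) :
    meanCurv M (c.F w) = ∑ j, ⟪b j, fderiv ℝ c.Y w (b j)⟫ := by
  classical
  have hν0 := M.unit_nu x0 hx0
  set A := fderiv ℝ M.nu (c.F w) with hA
  set ν := M.nu (c.F w) with hν
  set G := gradient c.g w with hG
  set ν0 := M.nu x0 with hν0d
  rw [_root_.meanCurv_eq, ← hA, ← hν]
  have e1 : (LinearMap.trace ℝ (Eu n)) (A : Eu n →ₗ[ℝ] Eu n) =
      ∑ j, ⟪b j, proj c.ι (A (c.ι (b j)))⟫ + ⟪ν0, A ν0⟫ := by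
    have hdec : (A : Eu n →ₗ[ℝ] Eu n) = ((A : Eu n →ₗ[ℝ] Eu n) ∘ₗ c.ι.toLinearMap) ∘ₗ
        (proj c.ι : Eu n →ₗ[ℝ] Wn n) + LinearMap.smulRight (innerSL ℝ ν0 : Eu n →ₗ[ℝ] ℝ) (A ν0) := by
      ext1 y
      simp only [LinearMap.add_apply, LinearMap.comp_apply, LinearMap.smulRight_apply]
      have := congrArg A (decomp c.ι ν0 hν0 c.ho y)
      rw [map_add, map_smul] at this
      exact this
    rw [hdec, map_add, LinearMap.trace_comp_comm']
    congr 1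
    · rw [LinearMap.trace_eq_sum_inner _ b]; rfl
    · rw [LinearMap.trace_smulRight]; rfl
  have e2 : ∑ j, ⟪b j, fderiv ℝ c.Y w (b j)⟫ = ∑ j, ⟪b j, proj c.ι (A (c.ι (b j)))⟫ +
      ⟪G, proj c.ι (A ν0)⟫ := by
    rw [c.fderivY w hw, ← b.sum_inner_mul_inner, ← Finset.sum_add_distrib]
    refine Finset.sum_congr rfl fun j _ => ?_
    simp only [ContinuousLinearMap.comp_apply, c.D_apply, map_add, map_smul, inner_add_right,
      inner_smul_right]
    rfl
  have hJ := (lt_of_lt_of_le one_pos (areaJ_one_le G)).ne'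
  have e3 : ⟪ν, A (areaJ G • ν0 - ν)⟫ = 0 := by
    have : ⟪areaJ G • ν0 - ν, ν⟫ = 0 := by
      have h0 : ⟪ν0, areaJ G • ν⟫ = 1 := by
        rw [c.Jnu w hw, inner_sub_right, real_inner_self_eq_norm_sq, hν0, real_inner_comm, c.ho]
        norm_num
      rw [inner_smul_right] at h0
      rw [inner_sub_left, inner_smul_left, real_inner_self_eq_norm_sq, M.unit_nu _ (c.mem w hw)]
      simp [h0]
    rw [← c.D_proj hx0 w hw _ this]
    exact c.nu_orth w hw _
  rw [map_sub, map_smul, inner_sub_right, inner_smul_right, sub_eq_zero] at e3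
  have e4 : ⟪G, proj c.ι (A ν0)⟫ = ⟪ν0, A ν0⟫ - areaJ G * ⟪ν, A ν0⟫ := by
    rw [inner_proj, show c.ι G = ν0 - areaJ G • ν by rw [c.Jnu w hw]; abel, inner_sub_left,
      inner_smul_left]; simp
  rw [e1, e2, e4, ← e3]; ring

/-- the divergence integrand -/
def dInt (M : Hypersurface n) (ψ : Eu n → ℝ) (e : Eu n) (x : Eu n) : ℝ :=
  ⟪e, tgrad M.nu ψ x⟫ - meanCurv M x * ⟪e, M.nu x⟫ * ψ x

theorem HChart.dInt_eq (c : HChart M x0) (hx0 : x0 ∈ M.carrier) (w : Wn n) (hw : c.F w ∈ c.V)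
    {κ : Type*} [Fintype κ] (b : OrthonormalBasis κ ℝ (Wn n))
    (ψ : Eu n → ℝ) (hψ : DifferentiableAt ℝ ψ (c.F w)) (e : Eu n) :
    areaJ (gradient c.g w) * dInt M ψ e (c.F w) =
      areaJ (gradient c.g w) * fderiv ℝ (ψ ∘ c.F) w (proj c.ι e) -
      (⟪M.nu x0, e⟫ - ⟪gradient c.g w, proj c.ι e⟫) *
      (fderiv ℝ (ψ ∘ c.F) w (c.Y w) + (ψ ∘ c.F) w * ∑ j, ⟪b j, fderiv ℝ c.Y w (b j)⟫) := by
  have h1 : areaJ (gradient c.g w) * ⟪e, M.nu (c.F w)⟫ =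
      ⟪M.nu x0, e⟫ - ⟪gradient c.g w, proj c.ι e⟫ := by
    rw [← inner_smul_right, c.Jnu w hw, inner_sub_right, inner_proj, real_inner_comm]
    rw [real_inner_comm (c.ι _) e]
  rw [dInt, c.tgrad_eq hx0 w hw ψ hψ, c.meanCurv_eq hx0 w hw b, ← h1, map_sub, map_smul, smul_eq_mul]
  simp only [Function.comp_apply]
  ring

theorem tgrad_zero (M : Hypersurface n) (ψ : Eu n → ℝ) (hψ : Differentiable ℝ ψ) (x : Eu n)
    (hx : x ∈ M.carrier) (U : Set (Eu n)) (hU : U ∈ 𝓝 x) (h0 : ∀ y ∈ M.carrier, y ∈ U → ψ y = 0) :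
    tgrad M.nu ψ x = 0 := by
  obtain ⟨c⟩ := exists_chart M x hx
  have : x ∈ range (graphF x c.ι (M.nu x) c.g) ∩ c.V := by rw [← c.hMV]; exact ⟨hx, c.hx0⟩
  obtain ⟨⟨w, hw⟩, -⟩ := this
  have hw : c.F w = x := hw
  have hwV : c.F w ∈ c.V := by rw [hw]; exact c.hx0
  apply ext_inner_left ℝ
  intro e
  rw [inner_zero_right]
  have := c.tgrad_eq hx w hwV ψ hψ.differentiableAt e
  rw [hw] at this
  rw [this]
  have hz : (ψ ∘ c.F) =ᶠ[𝓝 w] fun _ => 0 := by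
    have hU' : ∀ᶠ v in 𝓝 w, c.F v ∈ U :=
      c.contF.continuousAt.preimage_mem_nhds (by rw [hw]; exact hU)
    filter_upwards [c.near w hwV, hU'] with v hv hv2
    exact h0 _ (c.mem v hv) hv2
  rw [hz.fderiv_eq]; simp

end ident

section meas
open Measure Set Filter Topology Module
open scoped NNReal ENNReal

variable {M : Hypersurface n} {x0 : Eu n}

theorem haarW (n : ℕ) : (μH[(n : ℝ)] : Measure (Wn n)).IsAddHaarMeasure := by
  have := isAddHaarMeasure_hausdorffMeasure (E := Wn n)
  rwa [finrank_euclideanSpace_fin] at this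

theorem carrier_meas (M : Hypersurface n) : MeasurableSet M.carrier := by
  choose! U hU hxU f hf hMU hg hn using M.locally_level_set
  have : M.carrier = (⋃ x ∈ M.carrier, U x) ∩ closure M.carrier := by
    apply Subset.antisymm
    · intro x hx
      exact ⟨mem_biUnion hx (hxU x hx), subset_closure hx⟩
    · rintro x ⟨h1, h2⟩
      obtain ⟨y, hy, hxy⟩ := mem_iUnion₂.1 h1
      have h3 : x ∈ closure (M.carrier ∩ U y) := by
        rw [inter_comm]
        exact (hU y hy).inter_closure ⟨hxy, h2⟩
      have h4 : closure (M.carrier ∩ U y) ⊆ {z | f y z = 0} := by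
        apply closure_minimal
        · rw [hMU y hy]; exact fun z hz => hz.2
        · exact isClosed_eq (hf y hy).continuous continuous_const
      have : x ∈ M.carrier ∩ U y := by rw [hMU y hy]; exact ⟨hxy, h4 h3⟩
      exact this.1
  rw [this]
  exact ((isOpen_biUnion fun x hx => hU x hx).measurableSet).inter isClosed_closure.measurableSet

theorem HChart.emb (c : HChart M x0) (hx0 : x0 ∈ M.carrier) : Topology.IsClosedEmbedding c.F :=
  graphF_closedEmb x0 c.ι (M.nu x0) (M.unit_nu x0 hx0) c.ho c.g c.hg.continuous

theorem HChart.restr (c : HChart M x0) (hx0 : x0 ∈ M.carrier) :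
    (surfMeasure M).restrict c.V = (Measure.map c.F ((μH[(n : ℝ)] : Measure (Wn n)).withDensity
        (fun w => ENNReal.ofReal (areaJ (gradient c.g w))))).restrict c.V := by
  have h := graphF_area x0 c.ι (M.nu x0) (M.unit_nu x0 hx0) c.ho c.g (c.hg.of_le (by norm_num)) c.C c.hC
  rw [finrank_euclideanSpace_fin] at h
  rw [HChart.F, ← h, surfMeasure, restrict_restrict c.hV.measurableSet,
    restrict_restrict c.hV.measurableSet, inter_comm, c.hMV, inter_comm]

theorem HChart.Jmeas (c : HChart M x0) :
    Measurable (fun w => ENNReal.ofReal (areaJ (gradient c.g w))) := by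
  have : Continuous (fun w => areaJ (gradient c.g w)) :=
    areaJ_contDiff.continuous.comp (gradient_contDiff c.g c.hg).continuous
  exact this.measurable.ennreal_ofReal

theorem HChart.Jr (c : HChart M x0) (w : Wn n) :
    (ENNReal.ofReal (areaJ (gradient c.g w))).toReal = areaJ (gradient c.g w) :=
  ENNReal.toReal_ofReal (zero_le_one.trans (areaJ_one_le _))

theorem HChart.integrable_iff (c : HChart M x0) (hx0 : x0 ∈ M.carrier) (f : Eu n → ℝ)
    (hf : ∀ x ∉ c.V, f x = 0) : Integrable f (surfMeasure M) ↔
      Integrable (fun w => areaJ (gradient c.g w) * f (c.F w)) (μH[(n : ℝ)] : Measure (Wn n)) := by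
  have hs : Function.support f ⊆ c.V := by
    intro x hx; by_contra h; exact hx (hf x h)
  rw [← integrableOn_iff_integrable_of_support_subset hs, IntegrableOn, c.restr hx0, ← IntegrableOn,
    integrableOn_iff_integrable_of_support_subset hs,
    (c.emb hx0).measurableEmbedding.integrable_map_iff,
    integrable_withDensity_iff_integrable_smul' c.Jmeas (by simp)]
  simp only [c.Jr, smul_eq_mul, Function.comp_apply]

theorem HChart.integral_eq (c : HChart M x0) (hx0 : x0 ∈ M.carrier) (f : Eu n → ℝ)
    (hf : ∀ x ∉ c.V, f x = 0) : ∫ x, f x ∂(surfMeasure M) =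
      ∫ w, areaJ (gradient c.g w) * f (c.F w) ∂(μH[(n : ℝ)] : Measure (Wn n)) := by
  rw [← setIntegral_eq_integral_of_forall_compl_eq_zero hf, c.restr hx0,
    setIntegral_eq_integral_of_forall_compl_eq_zero hf,
    (c.emb hx0).measurableEmbedding.integral_map,
    integral_withDensity_eq_integral_toReal_smul c.Jmeas (by simp)]
  simp only [c.Jr, smul_eq_mul]

theorem HChart.F0 (c : HChart M x0) (hx0 : x0 ∈ M.carrier) : c.F 0 = x0 := by
  have : x0 ∈ range c.F ∩ c.V := by
    have h := c.hMV
    rw [HChart.F, ← h]; exact ⟨hx0, c.hx0⟩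
  obtain ⟨⟨w, hw⟩, -⟩ := this
  have h2 : proj c.ι (c.F w - x0) = w := graphF_proj x0 c.ι _ c.ho c.g w
  rw [hw, sub_self, map_zero] at h2
  rw [h2]; exact hw

theorem HChart.norm_le (c : HChart M x0) (hx0 : x0 ∈ M.carrier) (w : Wn n) : ‖w‖ ≤ ‖c.F w - x0‖ := by
  have := graphF_dist_le x0 c.ι (M.nu x0) (M.unit_nu x0 hx0) c.ho c.g w 0
  rw [sub_zero] at this
  have h0 := c.F0 hx0
  rw [HChart.F] at h0
  rwa [h0] at this

theorem HChart.Jle (c : HChart M x0) (w : Wn n) :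
    areaJ (gradient c.g w) ≤ √(1 + (c.C : ℝ) ^ 2) := by
  unfold areaJ
  apply Real.sqrt_le_sqrt
  have h1 : ‖gradient c.g w‖ ≤ c.C := by
    rw [gradient, LinearIsometryEquiv.norm_map]
    exact norm_fderiv_le_of_lipschitz ℝ c.hC
  gcongr

theorem local_int (M : Hypersurface n) (x0 : Eu n) (hx0 : x0 ∈ M.carrier) (a : ℝ) (ha : 0 ≤ a)
    (han : a < n) : ∃ U ∈ 𝓝 x0, IntegrableOn (fun x => ‖x‖ ^ (-a)) U (surfMeasure M) := by
  obtain ⟨c⟩ := exists_chart M x0 hx0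
  have hn : 1 ≤ n := by
    have : (0:ℝ) < n := lt_of_le_of_lt ha han
    exact_mod_cast this
  have hfr : finrank ℝ (Wn n) = n := finrank_euclideanSpace_fin
  have : Nontrivial (Wn n) := nontrivial_of_finrank_pos (R := ℝ) (by omega)
  have := haarW n
  have hnear : ∃ T : Set (Eu n), IsOpen T ∧ x0 ∈ T ∧ ∀ x ∈ T, x ≠ x0 → ‖x - x0‖ ≤ ‖x‖ := by
    by_cases h : x0 = 0
    · exact ⟨univ, isOpen_univ, mem_univ _, fun x _ _ => by simp [h]⟩
    · refine ⟨Metric.ball x0 (‖x0‖ / 2), Metric.isOpen_ball, by simpa using h, fun x hx _ => ?_⟩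
      rw [mem_ball_iff_norm] at hx
      have := norm_sub_norm_le x0 x
      rw [norm_sub_rev] at this
      linarith
  obtain ⟨T, hT, hxT, hle⟩ := hnear
  refine ⟨c.V ∩ T, (c.hV.inter hT).mem_nhds ⟨c.hx0, hxT⟩, ?_⟩
  have hms : MeasurableSet (c.V ∩ T) := (c.hV.inter hT).measurableSet
  rw [← integrable_indicator_iff hms, c.integrable_iff hx0]
  · obtain ⟨R, hR⟩ := c.hb.subset_ball x0
    have hR2 : ∀ w, c.F w ∈ c.V → ‖w‖ < R := by
      intro w hw
      have := hR hw
      rw [mem_ball_iff_norm] at this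
      exact (c.norm_le hx0 w).trans_lt this
    set f : Wn n → ℝ := fun w => areaJ (gradient c.g w) *
      ((c.V ∩ T).indicator (fun x => ‖x‖ ^ (-a)) (c.F w)) with hf
    have hs : Function.support f ⊆ Metric.ball 0 R := by
      intro w hw
      rw [mem_ball_zero_iff]
      apply hR2
      by_contra h
      apply hw
      simp [hf, h]
    rw [← integrableOn_iff_integrable_of_support_subset hs]
    have hmeas : Measurable f := by
      apply Measurable.mul
      · exact (areaJ_contDiff.continuous.comp (gradient_contDiff c.g c.hg).continuous).measurable
      · have : Measurable ((c.V ∩ T).indicator (fun x : Eu n => ‖x‖ ^ (-a))) :=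
          (Measurable.pow_const measurable_norm _).indicator hms
        exact this.comp c.contF.measurable
    refine integrableOn_ball_of_norm_le_rpow (C := √(1 + (c.C : ℝ) ^ 2)) (α := a) (by omega)
      (by rw [hfr]; exact han) ?_ hmeas.aestronglyMeasurable
    apply ae_restrict_of_ae
    have h0 : ∀ᵐ w ∂(μH[(n : ℝ)] : Measure (Wn n)), w ≠ 0 := by
      rw [ae_iff]; simp
    filter_upwards [h0] with w hw
    rw [hf, norm_mul]
    have hJ0 : 0 ≤ areaJ (gradient c.g w) := zero_le_one.trans (areaJ_one_le _)
    rw [Real.norm_of_nonneg hJ0]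
    apply mul_le_mul (c.Jle w) _ (norm_nonneg _) (Real.sqrt_nonneg _)
    have hwp : 0 < ‖w‖ := norm_pos_iff.2 hw
    by_cases h : c.F w ∈ c.V ∩ T
    · rw [indicator_of_mem h, Real.norm_of_nonneg (by positivity)]
      apply Real.rpow_le_rpow_of_nonpos hwp _ (by linarith)
      refine (c.norm_le hx0 w).trans (hle _ h.2 ?_)
      intro he
      have := c.norm_le hx0 w
      rw [he, sub_self, norm_zero] at this
      linarith
    · rw [indicator_of_notMem h, norm_zero]; positivity
  · intro x hx
    exact indicator_of_notMem (fun h => hx h.1) _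

theorem compact_int (M : Hypersurface n) (K : Set (Eu n)) (hK : IsCompact K) (hKM : K ⊆ M.carrier)
    (a : ℝ) (ha : 0 ≤ a) (han : a < n) : IntegrableOn (fun x => ‖x‖ ^ (-a)) K (surfMeasure M) := by
  refine hK.induction_on (p := fun s => IntegrableOn (fun x => ‖x‖ ^ (-a)) s (surfMeasure M))
    integrableOn_empty (fun s t hst h => h.mono_set hst) (fun s t hs ht => hs.union ht) ?_
  intro x hx
  obtain ⟨U, hU, h⟩ := local_int M x (hKM hx) a ha han
  exact ⟨U, mem_nhdsWithin_of_mem_nhds hU, h⟩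

theorem zero_null (M : Hypersurface n) (hn : 1 ≤ n) : ∀ᵐ x ∂(surfMeasure M), x ≠ 0 := by
  apply ae_restrict_of_ae
  have : NullSingletonClass (μH[(n : ℝ)] : Measure (Eu n)) :=
    nullSingletonClass_hausdorff _ (by positivity)
  rw [ae_iff]
  simp only [ne_eq, not_not]
  exact measure_singleton (0 : Eu n)

theorem mem_ae (M : Hypersurface n) : ∀ᵐ x ∂(surfMeasure M), x ∈ M.carrier :=
  ae_restrict_mem (carrier_meas M)

end meas

section divthm
open Measure Set Filter Topology Module
open scoped NNReal ENNReal Manifold ContDiff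

variable {M : Hypersurface n} {x0 : Eu n}

theorem dInt_zero (M : Hypersurface n) (ψ : Eu n → ℝ) (e x : Eu n) (hx : ψ =ᶠ[𝓝 x] fun _ => 0) :
    dInt M ψ e x = 0 := by
  rw [dInt, inner_tgrad, hx.fderiv_eq, hx.eq_of_nhds]; simp

theorem HChart.F_contDiff (c : HChart M x0) : ContDiff ℝ 1 c.F := by
  have : ContDiff ℝ 1 c.g := c.hg.of_le (by norm_num)
  have h2 : ContDiff ℝ 1 c.ι := c.ι.toContinuousLinearMap.contDiff
  have : c.F = fun w => x0 + c.ι w + c.g w • M.nu x0 := rfl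
  rw [this]
  fun_prop

theorem HChart.div (c : HChart M x0) (hx0 : x0 ∈ M.carrier) (ψ : Eu n → ℝ) (hψ : ContDiff ℝ 1 ψ)
    (hs : tsupport ψ ⊆ c.V) (e : Eu n) :
    Integrable (dInt M ψ e) (surfMeasure M) ∧ ∫ x, dInt M ψ e x ∂(surfMeasure M) = 0 := by
  have := haarW n
  have hcs : HasCompactSupport ψ :=
    Metric.isCompact_of_isClosed_isBounded (isClosed_tsupport ψ) (c.hb.subset hs)
  have hz : ∀ x ∉ c.V, ψ =ᶠ[𝓝 x] fun _ => 0 := fun x hx =>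
    notMem_tsupport_iff_eventuallyEq.1 fun h => hx (hs h)
  have hd0 : ∀ x ∉ c.V, dInt M ψ e x = 0 := fun x hx => dInt_zero M ψ e x (hz x hx)
  rw [c.integrable_iff hx0 _ hd0, c.integral_eq hx0 _ hd0]
  let b := EuclideanSpace.basisFun (Fin n) ℝ
  have key := graph_ibp b (μH[(n : ℝ)] : Measure (Wn n)) c.g c.hg (ψ ∘ c.F) (hψ.comp c.F_contDiff)
    (hcs.comp_isClosedEmbedding (c.emb hx0)) (proj c.ι e) ⟪M.nu x0, e⟫ c.Y (fun w => rfl)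
  have heq : (fun w => areaJ (gradient c.g w) * dInt M ψ e (c.F w)) = fun w =>
      areaJ (gradient c.g w) * fderiv ℝ (ψ ∘ c.F) w (proj c.ι e) -
      (⟪M.nu x0, e⟫ - ⟪gradient c.g w, proj c.ι e⟫) *
      (fderiv ℝ (ψ ∘ c.F) w (c.Y w) + (ψ ∘ c.F) w * ∑ j, ⟪b j, fderiv ℝ c.Y w (b j)⟫) := by
    funext w
    by_cases hw : c.F w ∈ c.V
    · exact c.dInt_eq hx0 w hw b ψ (hψ.differentiable (by norm_num)).differentiableAt e
    · have h0 : (ψ ∘ c.F) =ᶠ[𝓝 w] fun _ => 0 := c.contF.continuousAt.eventually (hz _ hw)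
      rw [hd0 _ hw, h0.fderiv_eq, h0.eq_of_nhds]; simp
  rw [heq]
  exact key

theorem dInt_sub (M : Hypersurface n) (ψ χ : Eu n → ℝ) (hψ : Differentiable ℝ ψ)
    (hχ : Differentiable ℝ χ) (e x : Eu n) :
    dInt M (fun y => ψ y - χ y) e x = dInt M ψ e x - dInt M χ e x := by
  simp only [dInt, inner_tgrad]
  rw [fderiv_fun_sub hψ.differentiableAt hχ.differentiableAt]
  simp only [_root_.sub_apply]
  ring

theorem dInt_sum (M : Hypersurface n) {κ : Type*} [Fintype κ] (ψ : κ → Eu n → ℝ)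
    (hψ : ∀ i, Differentiable ℝ (ψ i)) (e x : Eu n) :
    dInt M (fun y => ∑ i, ψ i y) e x = ∑ i, dInt M (ψ i) e x := by
  simp only [dInt, inner_tgrad]
  rw [fderiv_fun_sum fun i _ => (hψ i).differentiableAt]
  simp only [_root_.sum_apply, Finset.sum_sub_distrib, Finset.mul_sum]

theorem div_thm (M : Hypersurface n) (ψ : Eu n → ℝ) (h : C1cOn M.carrier ψ) (e : Eu n) :
    Integrable (dInt M ψ e) (surfMeasure M) ∧ ∫ x, dInt M ψ e x ∂(surfMeasure M) = 0 := by
  obtain ⟨hψ, K, hK, hKM, hψ0⟩ := h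
  have hdψ : Differentiable ℝ ψ := hψ.differentiable (by norm_num)
  have c : ∀ x, x ∈ K → HChart M x := fun x hx => (exists_chart M x (hKM hx)).some
  obtain ⟨t, ht⟩ := hK.elim_finite_subcover (fun x : K => (c x.1 x.2).V)
    (fun x => (c x.1 x.2).hV) (fun x hx => mem_iUnion.2 ⟨⟨x, hx⟩, (c x hx).hx0⟩)
  obtain ⟨ρ, hρ⟩ := SmoothPartitionOfUnity.exists_isSubordinate 𝓘(ℝ, Eu n) hK.isClosed
    (fun i : t => (c i.1.1 i.1.2).V) (fun i => (c i.1.1 i.1.2).hV) (by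
      intro x hx
      obtain ⟨i, hi, hx⟩ := mem_iUnion₂.1 (ht hx)
      exact mem_iUnion.2 ⟨⟨i, hi⟩, hx⟩)
  have hρc : ∀ i : t, ContDiff ℝ 1 (fun x => ρ i x * ψ x) := fun i =>
    (((ρ i).contMDiff.contDiff).of_le (by exact_mod_cast le_top)).mul hψ
  have hloc : ∀ i : t, Integrable (dInt M (fun x => ρ i x * ψ x) e) (surfMeasure M) ∧
      ∫ x, dInt M (fun x => ρ i x * ψ x) e x ∂(surfMeasure M) = 0 := fun i =>
    (c i.1.1 i.1.2).div (hKM i.1.2) _ (hρc i) ((tsupport_mul_subset_left).trans (hρ i)) e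
  have hdi : ∀ i : t, Differentiable ℝ (fun x => ρ i x * ψ x) := fun i =>
    (hρc i).differentiable (by norm_num)
  have hsum : ∀ x ∈ M.carrier, dInt M ψ e x = ∑ i, dInt M (fun x => ρ i x * ψ x) e x := by
    intro x hx
    have hds : Differentiable ℝ (fun y => ∑ i, ρ i y * ψ y) := Differentiable.fun_sum fun i _ => hdi i
    have hv : ∀ y ∈ M.carrier, y ∈ (univ : Set (Eu n)) → ψ y - ∑ i, ρ i y * ψ y = 0 := by
      intro y hy _
      by_cases hyK : y ∈ K
      · have := ρ.sum_eq_one hyK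
        rw [finsum_eq_sum_of_fintype] at this
        rw [← Finset.sum_mul, this]; ring
      · rw [hψ0 y hy hyK]; simp
    have h1 := dInt_sub M ψ _ hdψ hds e x
    have h2 : dInt M (fun y => ψ y - ∑ i, ρ i y * ψ y) e x = 0 := by
      rw [dInt, tgrad_zero M _ (hdψ.fun_sub hds) x hx univ univ_mem hv, hv x hx (mem_univ _)]
      simp
    rw [h2] at h1
    rw [← dInt_sum M _ hdi]
    linarith
  have hae : dInt M ψ e =ᵐ[surfMeasure M] fun x => ∑ i, dInt M (fun x => ρ i x * ψ x) e x := by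
    filter_upwards [mem_ae M] with x hx using hsum x hx
  constructor
  · rw [integrable_congr hae]
    exact integrable_finsetSum _ fun i _ => (hloc i).1
  · rw [integral_congr_ae hae, integral_finsetSum _ fun i _ => (hloc i).1]
    exact Finset.sum_eq_zero fun i _ => (hloc i).2

end divthm

section hardy
open Measure Set Filter Topology Module
open scoped NNReal ENNReal ContDiff

theorem euler (M : Hypersurface n) (u : Eu n → ℝ) (h : C1cOn M.carrier u) :
    Integrable (fun x => n * u x + fderiv ℝ u x (x - ⟪x, M.nu x⟫ • M.nu x)
      - meanCurv M x * ⟪x, M.nu x⟫ * u x) (surfMeasure M) ∧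
    ∫ x, (n * u x + fderiv ℝ u x (x - ⟪x, M.nu x⟫ • M.nu x)
      - meanCurv M x * ⟪x, M.nu x⟫ * u x) ∂(surfMeasure M) = 0 := by
  obtain ⟨hu, K, hK, hKM, hu0⟩ := h
  have hdu : Differentiable ℝ u := hu.differentiable (by norm_num)
  have hC : ∀ i : Fin (n+1), C1cOn M.carrier (fun x => x i * u x) := by
    intro i
    refine ⟨?_, K, hK, hKM, fun x hx hxK => by simp [hu0 x hx hxK]⟩
    exact ((EuclideanSpace.proj (𝕜 := ℝ) i).contDiff).mul hu
  have hdiv := fun i => div_thm M _ (hC i) (EuclideanSpace.single i (1:ℝ))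
  have hfd : ∀ (i : Fin (n+1)) (x v : Eu n), fderiv ℝ (fun x : Eu n => x i * u x) x v =
      x i * fderiv ℝ u x v + u x * v i := by
    intro i x v
    have h1 : HasFDerivAt (fun x : Eu n => x i) (EuclideanSpace.proj (𝕜 := ℝ) i) x :=
      (EuclideanSpace.proj (𝕜 := ℝ) i).hasFDerivAt
    have := (h1.mul hdu.differentiableAt.hasFDerivAt).fderiv
    have h3 := congrArg (fun L => L v) this
    exact h3
  have hsum : ∀ x ∈ M.carrier, n * u x + fderiv ℝ u x (x - ⟪x, M.nu x⟫ • M.nu x)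
      - meanCurv M x * ⟪x, M.nu x⟫ * u x =
      ∑ i : Fin (n+1), dInt M (fun x => x i * u x) (EuclideanSpace.single i (1:ℝ)) x := by
    intro x hx
    have hν := M.unit_nu x hx
    set ν := M.nu x with hνd
    have e1 : ∑ i, ν i * ν i = 1 := by
      have := real_inner_self_eq_norm_sq ν
      rw [hν, PiLp.inner_apply] at this
      simpa [pow_two] using this
    have e2 : ⟪x, ν⟫ = ∑ i, x i * ν i := by
      rw [PiLp.inner_apply]; simp [mul_comm]
    have e3 : x = ∑ j, x j • EuclideanSpace.single j (1:ℝ) := by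
      ext k
      simp [Pi.single_apply]
    have e4 : fderiv ℝ u x x = ∑ j, x j * fderiv ℝ u x (EuclideanSpace.single j (1:ℝ)) := by
      conv_lhs => rw [show fderiv ℝ u x x = fderiv ℝ u x (∑ j, x j • EuclideanSpace.single j (1:ℝ)) by
        rw [← e3]]
      simp only [_root_.map_sum, map_smul, smul_eq_mul]
    have e5 : ∀ i, dInt M (fun x => x i * u x) (EuclideanSpace.single i (1:ℝ)) x =
        x i * fderiv ℝ u x (EuclideanSpace.single i (1:ℝ)) - (x i * ν i) * fderiv ℝ u x ν
          + (u x - u x * (ν i * ν i)) - meanCurv M x * u x * (x i * ν i) := by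
      intro i
      rw [dInt, inner_tgrad, hfd, ← hνd]
      simp only [EuclideanSpace.inner_single_left, map_sub, map_smul, smul_eq_mul, PiLp.sub_apply,
        PiLp.smul_apply, map_one, one_mul, PiLp.single_apply, if_true]
      ring
    simp only [e5]
    rw [Finset.sum_sub_distrib, Finset.sum_add_distrib, Finset.sum_sub_distrib, Finset.sum_sub_distrib,
      ← Finset.sum_mul, ← Finset.mul_sum, ← Finset.mul_sum, ← e4, ← e2, e1, map_sub, map_smul,
      smul_eq_mul, Finset.sum_const, Finset.card_univ, Fintype.card_fin, nsmul_eq_mul]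
    push_cast
    ring
  have hae := (mem_ae M).mono hsum
  have hae' : (fun x => n * u x + fderiv ℝ u x (x - ⟪x, M.nu x⟫ • M.nu x)
      - meanCurv M x * ⟪x, M.nu x⟫ * u x) =ᵐ[surfMeasure M] fun x =>
      ∑ i : Fin (n+1), dInt M (fun x => x i * u x) (EuclideanSpace.single i (1:ℝ)) x := hae
  constructor
  · rw [integrable_congr hae']
    exact integrable_finsetSum _ fun i _ => (hdiv i).1
  · rw [integral_congr_ae hae', integral_finsetSum _ fun i _ => (hdiv i).1]
    exact Finset.sum_eq_zero fun i _ => (hdiv i).2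

/-- gradient term -/
def Gq (M : Hypersurface n) (φ : Eu n → ℝ) (q : ℝ) (x : Eu n) : Eu n :=
  q • tgrad M.nu φ x - (meanCurv M x * φ x) • M.nu x

/-- left integrand -/
def Aq (M : Hypersurface n) (φ : Eu n → ℝ) (a q ε : ℝ) (x : Eu n) : ℝ :=
  (‖x‖ ^ 2 + ε) ^ (-(a / 2)) * |φ x| ^ q *
    (n - a * (‖x‖ ^ 2 - ⟪x, M.nu x⟫ ^ 2) / (‖x‖ ^ 2 + ε))

/-- right integrand -/
def Bq (M : Hypersurface n) (φ : Eu n → ℝ) (a q ε : ℝ) (x : Eu n) : ℝ :=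
  (‖x‖ ^ 2 + ε) ^ (-(a / 2)) * |φ x| ^ (q - 1) * (‖x‖ * ‖Gq M φ q x‖)

theorem hardy_reg (M : Hypersurface n) (φ : Eu n → ℝ) (hφ : C1cOn M.carrier φ) (a q ε : ℝ)
    (hq : 1 < q) (hε : 0 < ε) (hA : Integrable (Aq M φ a q ε) (surfMeasure M))
    (hB : Integrable (Bq M φ a q ε) (surfMeasure M)) :
    ∫ x, Aq M φ a q ε x ∂(surfMeasure M) ≤ ∫ x, Bq M φ a q ε x ∂(surfMeasure M) := by
  obtain ⟨hφc, K, hK, hKM, hφ0⟩ := hφ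
  have hpos : ∀ x : Eu n, 0 < ‖x‖ ^ 2 + ε := fun x => by positivity
  have hdφ : Differentiable ℝ φ := hφc.differentiable (by norm_num)
  set u : Eu n → ℝ := fun x => |φ x| ^ q * (‖x‖ ^ 2 + ε) ^ (-(a / 2)) with hu
  have huC : C1cOn M.carrier u := by
    refine ⟨?_, K, hK, hKM, fun x hx hxK => ?_⟩
    · apply ContDiff.mul
      · exact hφc.norm_rpow hq
      · have h1 : ContDiff ℝ 1 (fun x : Eu n => ‖x‖ ^ 2 + ε) := (contDiff_norm_sq ℝ).add contDiff_const
        exact h1.rpow_const_of_ne fun x => (hpos x).ne'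
    · simp only [hu, hφ0 x hx hxK, abs_zero]
      rw [Real.zero_rpow (by linarith), zero_mul]
  obtain ⟨e1, e2⟩ := euler M u huC
  have hfd : ∀ x z, fderiv ℝ u x z = q * |φ x| ^ (q - 2) * φ x * fderiv ℝ φ x z *
      (‖x‖ ^ 2 + ε) ^ (-(a / 2)) - a * |φ x| ^ q * (‖x‖ ^ 2 + ε) ^ (-(a / 2)) * ⟪x, z⟫ /
        (‖x‖ ^ 2 + ε) := by
    intro x z
    have h1 : HasFDerivAt (fun x => |φ x| ^ q) ((q * |φ x| ^ (q - 2) * φ x) • fderiv ℝ φ x) x :=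
      (hasDerivAt_abs_rpow (φ x) hq).comp_hasFDerivAt x hdφ.differentiableAt.hasFDerivAt
    have h2 : HasFDerivAt (fun x : Eu n => ‖x‖ ^ 2 + ε) ((2:ℝ) • innerSL ℝ x) x := by
      have := ((hasFDerivAt_id x).norm_sq).add_const ε
      rw [ContinuousLinearMap.comp_id] at this
      rw [show (2:ℝ) • innerSL ℝ x = 2 • innerSL ℝ x by rw [two_smul, two_smul]]
      exact this
    have h3 := h2.rpow_const (p := -(a / 2)) (Or.inl (hpos x).ne')
    have h4 := congrArg (fun L => L z) (h1.mul h3).fderiv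
    refine h4.trans ?_
    have : (‖x‖ ^ 2 + ε) ^ (-(a / 2) - 1) = (‖x‖ ^ 2 + ε) ^ (-(a / 2)) / (‖x‖ ^ 2 + ε) := by
      rw [Real.rpow_sub (hpos x), Real.rpow_one]
    simp only [_root_.add_apply, _root_.smul_apply, smul_eq_mul, this, innerSL_apply_apply]
    ring
  have hle : ∀ x ∈ M.carrier, Aq M φ a q ε x - Bq M φ a q ε x ≤
      n * u x + fderiv ℝ u x (x - ⟪x, M.nu x⟫ • M.nu x) - meanCurv M x * ⟪x, M.nu x⟫ * u x := by
    intro x hx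
    rw [hfd]
    have hin : ⟪x, x - ⟪x, M.nu x⟫ • M.nu x⟫ = ‖x‖ ^ 2 - ⟪x, M.nu x⟫ ^ 2 := by
      rw [inner_sub_right, inner_smul_right, real_inner_self_eq_norm_sq]; ring
    rw [hin]
    have hG : q * fderiv ℝ φ x (x - ⟪x, M.nu x⟫ • M.nu x) - meanCurv M x * φ x * ⟪x, M.nu x⟫ =
        ⟪x, Gq M φ q x⟫ := by
      rw [Gq, inner_sub_right, inner_smul_right, inner_smul_right, inner_tgrad]
    have hp : |φ x| ^ q = |φ x| ^ (q - 2) * φ x * φ x := by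
      rcases eq_or_ne (φ x) 0 with h | h
      · rw [h, abs_zero, Real.zero_rpow (by linarith)]; simp
      · rw [mul_assoc, ← abs_mul_abs_self, ← pow_two, ← Real.rpow_natCast,
          ← Real.rpow_add (abs_pos.2 h)]; norm_num
    have hp1 : |(|φ x| ^ (q - 2) * φ x)| ≤ |φ x| ^ (q - 1) := by
      rcases eq_or_ne (φ x) 0 with h | h
      · rw [h]; simp only [mul_zero, abs_zero]; positivity
      · rw [abs_mul, abs_of_nonneg (by positivity), ← Real.rpow_add_one (abs_pos.2 h).ne']
        apply le_of_eq; congr 1; ring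
    have hCS : |(⟪x, Gq M φ q x⟫ : ℝ)| ≤ ‖x‖ * ‖Gq M φ q x‖ := abs_real_inner_le_norm _ _
    have hmain : -(|φ x| ^ (q - 1) * (‖x‖ * ‖Gq M φ q x‖)) ≤
        (|φ x| ^ (q - 2) * φ x) * ⟪x, Gq M φ q x⟫ := by
      apply neg_le_of_abs_le
      rw [abs_mul]
      gcongr
    have hw : 0 ≤ (‖x‖ ^ 2 + ε) ^ (-(a / 2)) := Real.rpow_nonneg (hpos x).le _
    have hm2 := mul_le_mul_of_nonneg_left hmain hw
    have : n * u x + (q * |φ x| ^ (q - 2) * φ x * fderiv ℝ φ x (x - ⟪x, M.nu x⟫ • M.nu x) *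
      (‖x‖ ^ 2 + ε) ^ (-(a / 2)) - a * |φ x| ^ q * (‖x‖ ^ 2 + ε) ^ (-(a / 2)) *
       (‖x‖ ^ 2 - ⟪x, M.nu x⟫ ^ 2) / (‖x‖ ^ 2 + ε)) - meanCurv M x * ⟪x, M.nu x⟫ * u x =
       Aq M φ a q ε x + (‖x‖ ^ 2 + ε) ^ (-(a / 2)) * ((|φ x| ^ (q - 2) * φ x) * ⟪x, Gq M φ q x⟫) := by
      rw [← hG, Aq, hu]
      simp only [hp]
      ring
    rw [this, Bq]
    linarith
  have := integral_mono_ae (hA.sub hB) e1 ((mem_ae M).mono hle)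
  rw [e2] at this
  simp only [Pi.sub_apply] at this
  rw [integral_sub hA hB] at this
  linarith

end hardy

section hardy2
open Measure Set Filter Topology Module
open scoped NNReal ENNReal ContDiff

theorem tgrad_cont (M : Hypersurface n) (φ : Eu n → ℝ) (hφ : ContDiff ℝ 1 φ) :
    Continuous (tgrad M.nu φ) := by
  have h1 : Continuous (gradient φ) :=
    (InnerProductSpace.toDual ℝ (Eu n)).symm.continuous.comp (hφ.continuous_fderiv (by norm_num))
  have h2 : Continuous M.nu := M.smooth_nu.continuous
  unfold tgrad
  fun_prop

theorem meanCurv_cont (M : Hypersurface n) : Continuous (meanCurv M) := by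
  have h2 : Continuous M.nu := M.smooth_nu.continuous
  have h3 : ∀ i, Continuous (fun x => M.nu x i) := fun i =>
    (EuclideanSpace.proj (𝕜 := ℝ) i).continuous.comp h2
  have h4 : ∀ (i : Fin (n+1)) (v : Eu n), Continuous (fun x => fderiv ℝ (fun y => M.nu y i) x v) := by
    intro i v
    have : ContDiff ℝ (⊤ : ℕ∞) (fun y => M.nu y i) :=
      (EuclideanSpace.proj (𝕜 := ℝ) i).contDiff.comp M.smooth_nu
    exact (this.continuous_fderiv (by norm_num)).clm_apply continuous_const
  unfold meanCurv tdiv tderiv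
  refine continuous_finset_sum _ fun i _ => (h4 i _).sub ((h3 i).mul ?_)
  exact continuous_finset_sum _ fun j _ => (h4 i _).mul (h3 j)

theorem Gq_cont (M : Hypersurface n) (φ : Eu n → ℝ) (hφ : ContDiff ℝ 1 φ) (q : ℝ) :
    Continuous (Gq M φ q) := by
  have h1 := tgrad_cont M φ hφ
  have h2 := meanCurv_cont M
  have h3 : Continuous M.nu := M.smooth_nu.continuous
  have h4 := hφ.continuous
  unfold Gq
  fun_prop

theorem bdd_on (K : Set (Eu n)) (hK : IsCompact K) {H : Type*} [NormedAddCommGroup H] (f : Eu n → H)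
    (hf : Continuous f) : ∃ C, 1 ≤ C ∧ ∀ x ∈ K, ‖f x‖ ≤ C := by
  obtain ⟨C, hC⟩ := hK.exists_bound_of_continuousOn hf.continuousOn
  exact ⟨max 1 C, le_max_left _ _, fun x hx => (hC x hx).trans (le_max_right _ _)⟩

theorem Gq_bound (M : Hypersurface n) (φ : Eu n → ℝ) (hφ : ContDiff ℝ 1 φ) (K : Set (Eu n))
    (hK : IsCompact K) (hKM : K ⊆ M.carrier) (p : ℝ) : ∃ L, 0 ≤ L ∧ ∀ q, 0 ≤ q → q ≤ p + 1 → ∀ x ∈ K,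
      ‖Gq M φ q x‖ ≤ L := by
  obtain ⟨T, hT1, hT⟩ := bdd_on K hK _ (tgrad_cont M φ hφ)
  obtain ⟨h, hh1, hh⟩ := bdd_on K hK _ ((meanCurv_cont M).mul hφ.continuous)
  refine ⟨|p + 1| * T + h, by positivity, fun q hq hqp x hx => ?_⟩
  refine (norm_sub_le _ _).trans ?_
  rw [norm_smul, norm_smul, M.unit_nu x (hKM hx), mul_one]
  apply add_le_add _ (hh x hx)
  rw [Real.norm_of_nonneg hq]
  apply mul_le_mul (hqp.trans (le_abs_self _)) (hT x hx) (norm_nonneg _) (abs_nonneg _)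

theorem ind_int (M : Hypersurface n) (K : Set (Eu n)) (hK : IsCompact K) (hKM : K ⊆ M.carrier)
    (a : ℝ) (ha : 0 ≤ a) (han : a < n) (f : Eu n → ℝ) (hf : Measurable f) (C : ℝ)
    (h0 : ∀ x ∈ M.carrier, x ≠ 0 → ‖f x‖ ≤ C * K.indicator (fun x => ‖x‖ ^ (-a)) x) :
    Integrable f (surfMeasure M) := by
  have hn : 1 ≤ n := by
    have : (0:ℝ) < n := lt_of_le_of_lt ha han
    exact_mod_cast this
  have hI := ((integrable_indicator_iff hK.measurableSet).2 (compact_int M K hK hKM a ha han)).const_mul C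
  refine hI.mono' hf.aestronglyMeasurable ?_
  filter_upwards [mem_ae M, zero_null M hn] with x h1 h2 using h0 x h1 h2

theorem weight_le (x : Eu n) (hx : x ≠ 0) (a ε : ℝ) (ha : 0 ≤ a) (hε : 0 ≤ ε) :
    (‖x‖ ^ 2 + ε) ^ (-(a / 2)) ≤ ‖x‖ ^ (-a) := by
  have hx' : 0 < ‖x‖ := norm_pos_iff.2 hx
  have h1 : ‖x‖ ^ (-a) = (‖x‖ ^ 2) ^ (-(a / 2)) := by
    rw [← Real.rpow_natCast, ← Real.rpow_mul hx'.le]; congr 1; push_cast; ring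
  rw [h1]
  exact Real.rpow_le_rpow_of_nonpos (by positivity) (by linarith) (by linarith)

theorem Aq_bound (M : Hypersurface n) (φ : Eu n → ℝ) (a q ε p m : ℝ) (K : Set (Eu n))
    (hφ0 : ∀ x ∈ M.carrier, x ∉ K → φ x = 0) (hm1 : 1 ≤ m) (hm : ∀ x ∈ K, ‖φ x‖ ≤ m)
    (ha : 0 ≤ a) (han : a < n) (hq : 0 < q) (hqp : q ≤ p + 1) (hε : 0 ≤ ε) (x : Eu n)
    (hx : x ∈ M.carrier) (hx0 : x ≠ 0) :
    ‖Aq M φ a q ε x‖ ≤ (m ^ (p + 1) * n) * K.indicator (fun x => ‖x‖ ^ (-a)) x := by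
  by_cases hxK : x ∈ K
  swap
  · rw [indicator_of_notMem hxK, mul_zero, Aq, hφ0 x hx hxK, abs_zero, Real.zero_rpow hq.ne']; simp
  rw [indicator_of_mem hxK, Aq, norm_mul, norm_mul]
  have hx' : 0 < ‖x‖ := norm_pos_iff.2 hx0
  have hp : 0 < ‖x‖ ^ 2 + ε := by positivity
  have h1 : ‖(‖x‖ ^ 2 + ε) ^ (-(a / 2))‖ ≤ ‖x‖ ^ (-a) := by
    rw [Real.norm_of_nonneg (by positivity)]; exact weight_le x hx0 a ε ha hε
  have h2 : ‖|φ x| ^ q‖ ≤ m ^ (p + 1) := by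
    rw [Real.norm_of_nonneg (by positivity)]
    exact (Real.rpow_le_rpow (abs_nonneg _) (hm x hxK) hq.le).trans
      (Real.rpow_le_rpow_of_exponent_le hm1 hqp)
  have h3 : ‖(n:ℝ) - a * (‖x‖ ^ 2 - ⟪x, M.nu x⟫ ^ 2) / (‖x‖ ^ 2 + ε)‖ ≤ n := by
    have hs : ⟪x, M.nu x⟫ ^ 2 ≤ ‖x‖ ^ 2 := by
      have := abs_real_inner_le_norm x (M.nu x)
      rw [M.unit_nu x hx, mul_one] at this
      rw [← sq_abs]; gcongr
    have t1 : 0 ≤ a * (‖x‖ ^ 2 - ⟪x, M.nu x⟫ ^ 2) / (‖x‖ ^ 2 + ε) :=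
      div_nonneg (mul_nonneg ha (by linarith)) hp.le
    have t2 : a * (‖x‖ ^ 2 - ⟪x, M.nu x⟫ ^ 2) / (‖x‖ ^ 2 + ε) ≤ a := by
      rw [div_le_iff₀ hp]
      apply mul_le_mul_of_nonneg_left _ ha
      nlinarith [sq_nonneg (⟪x, M.nu x⟫ : ℝ)]
    rw [Real.norm_of_nonneg (by linarith)]; linarith
  calc _ ≤ ‖x‖ ^ (-a) * m ^ (p + 1) * n := by
        apply mul_le_mul (mul_le_mul h1 h2 (norm_nonneg _) (by positivity)) h3 (norm_nonneg _)
        positivity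
    _ = _ := by ring

theorem Bq_bound (M : Hypersurface n) (φ : Eu n → ℝ) (a q ε p m R L : ℝ) (K : Set (Eu n))
    (hφ0 : ∀ x ∈ M.carrier, x ∉ K → φ x = 0) (hm1 : 1 ≤ m) (hm : ∀ x ∈ K, ‖φ x‖ ≤ m)
    (hR1 : 1 ≤ R) (hR : ∀ x ∈ K, ‖x‖ ≤ R) (hL0 : 0 ≤ L) (hL : ∀ x ∈ K, ‖Gq M φ q x‖ ≤ L)
    (ha : 0 ≤ a) (hq : 1 ≤ q) (hqp : q ≤ p + 1) (hε : 0 ≤ ε) (x : Eu n)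
    (hz : x ∉ K → Gq M φ q x = 0 ∨ 1 < q)
    (hx : x ∈ M.carrier) (hx0 : x ≠ 0) :
    ‖Bq M φ a q ε x‖ ≤ (m ^ p * (R * L)) * K.indicator (fun x => ‖x‖ ^ (-a)) x := by
  by_cases hxK : x ∈ K
  swap
  · rw [indicator_of_notMem hxK, mul_zero, Bq]
    rcases hz hxK with h | h
    · simp [h]
    · rw [hφ0 x hx hxK, abs_zero, Real.zero_rpow (by linarith)]; simp
  rw [indicator_of_mem hxK, Bq, norm_mul, norm_mul, norm_mul, norm_norm, norm_norm]
  have hx' : 0 < ‖x‖ := norm_pos_iff.2 hx0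
  have hp : 0 < ‖x‖ ^ 2 + ε := by positivity
  have h1 : ‖(‖x‖ ^ 2 + ε) ^ (-(a / 2))‖ ≤ ‖x‖ ^ (-a) := by
    rw [Real.norm_of_nonneg (by positivity)]; exact weight_le x hx0 a ε ha hε
  have h2 : ‖|φ x| ^ (q - 1)‖ ≤ m ^ p := by
    rw [Real.norm_of_nonneg (by positivity)]
    exact (Real.rpow_le_rpow (abs_nonneg _) (hm x hxK) (by linarith)).trans
      (Real.rpow_le_rpow_of_exponent_le hm1 (by linarith))
  calc _ ≤ ‖x‖ ^ (-a) * m ^ p * (R * L) := by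
        apply mul_le_mul (mul_le_mul h1 h2 (norm_nonneg _) (by positivity))
          (mul_le_mul (hR x hxK) (hL x hxK) (norm_nonneg _) (by positivity)) (by positivity)
        positivity
    _ = _ := by ring

theorem Aq_meas (M : Hypersurface n) (φ : Eu n → ℝ) (hφ : ContDiff ℝ 1 φ) (a q ε : ℝ) :
    Measurable (Aq M φ a q ε) := by
  have h1 : Measurable (fun x : Eu n => ‖x‖ ^ 2) := by fun_prop
  have h2 : Measurable (fun x => |φ x|) := hφ.continuous.abs.measurable
  have h3 : Measurable (fun x => (⟪x, M.nu x⟫ : ℝ)) :=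
    (continuous_id.inner M.smooth_nu.continuous).measurable
  unfold Aq
  exact (((h1.add_const ε).pow_const _).mul (h2.pow_const _)).mul
    (measurable_const.sub (((h1.sub (h3.pow_const 2)).const_mul a).div (h1.add_const ε)))

theorem Bq_meas (M : Hypersurface n) (φ : Eu n → ℝ) (hφ : ContDiff ℝ 1 φ) (a q ε : ℝ) :
    Measurable (Bq M φ a q ε) := by
  have h1 : Measurable (fun x : Eu n => ‖x‖ ^ 2) := by fun_prop
  have h2 : Measurable (fun x => |φ x|) := hφ.continuous.abs.measurable
  have h3 : Measurable (fun x => ‖Gq M φ q x‖) := (Gq_cont M φ hφ q).norm.measurable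
  unfold Bq
  exact (((h1.add_const ε).pow_const _).mul (h2.pow_const _)).mul (measurable_norm.mul h3)

theorem Gq_zero (M : Hypersurface n) (φ : Eu n → ℝ) (hφ : ContDiff ℝ 1 φ) (K : Set (Eu n))
    (hK : IsCompact K) (hφ0 : ∀ x ∈ M.carrier, x ∉ K → φ x = 0) (q : ℝ) (x : Eu n)
    (hx : x ∈ M.carrier) (hxK : x ∉ K) : Gq M φ q x = 0 := by
  rw [Gq, hφ0 x hx hxK, tgrad_zero M φ (hφ.differentiable (by norm_num)) x hx Kᶜ
    (hK.isClosed.isOpen_compl.mem_nhds hxK) (fun y hy hyK => hφ0 y hy hyK)]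
  simp

theorem hardy_limit (M : Hypersurface n) (p a : ℝ) (hp : 1 ≤ p)
    (ha : 0 ≤ a) (han : a < n) (φ : Eu n → ℝ) (hφ : C1cOn M.carrier φ) :
    Integrable (Aq M φ a p 0) (surfMeasure M) ∧ Integrable (Bq M φ a p 0) (surfMeasure M) ∧
    ∫ x, Aq M φ a p 0 x ∂(surfMeasure M) ≤ ∫ x, Bq M φ a p 0 x ∂(surfMeasure M) := by
  obtain ⟨hφc, K, hK, hKM, hφ0⟩ := id hφ
  have hn : 1 ≤ n := by
    have : (0:ℝ) < n := lt_of_le_of_lt ha han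
    exact_mod_cast this
  obtain ⟨m, hm1, hm⟩ := bdd_on K hK φ hφc.continuous
  obtain ⟨R, hR1, hR⟩ := bdd_on K hK id continuous_id
  obtain ⟨L, hL0, hL⟩ := Gq_bound M φ hφc K hK hKM p
  have hind := (integrable_indicator_iff hK.measurableSet).2 (compact_int M K hK hKM a ha han)
  have hAb : ∀ q ε, 0 < q → q ≤ p + 1 → 0 ≤ ε → ∀ x ∈ M.carrier, x ≠ 0 →
    ‖Aq M φ a q ε x‖ ≤ (m ^ (p + 1) * n) * K.indicator (fun x => ‖x‖ ^ (-a)) x :=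
    fun q ε h1 h2 h3 x hx hx0 => Aq_bound M φ a q ε p m K hφ0 hm1 hm ha han h1 h2 h3 x hx hx0
  have hBb : ∀ q ε, 1 ≤ q → q ≤ p + 1 → 0 ≤ ε → ∀ x ∈ M.carrier, x ≠ 0 →
    ‖Bq M φ a q ε x‖ ≤ (m ^ p * (R * L)) * K.indicator (fun x => ‖x‖ ^ (-a)) x :=
    fun q ε h1 h2 h3 x hx hx0 => Bq_bound M φ a q ε p m R L K hφ0 hm1 hm hR1 hR hL0
      (hL q (by linarith) h2) ha h1 h2 h3 x
      (fun hxK => Or.inl (Gq_zero M φ hφc K hK hφ0 q x hx hxK)) hx hx0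
  have hAi : ∀ q ε, 0 < q → q ≤ p + 1 → 0 ≤ ε → Integrable (Aq M φ a q ε) (surfMeasure M) :=
    fun q ε h1 h2 h3 => ind_int M K hK hKM a ha han _ (Aq_meas M φ hφc a q ε) _ (hAb q ε h1 h2 h3)
  have hBi : ∀ q ε, 1 ≤ q → q ≤ p + 1 → 0 ≤ ε → Integrable (Bq M φ a q ε) (surfMeasure M) :=
    fun q ε h1 h2 h3 => ind_int M K hK hKM a ha han _ (Bq_meas M φ hφc a q ε) _ (hBb q ε h1 h2 h3)
  refine ⟨hAi p 0 (by linarith) (by linarith) le_rfl, hBi p 0 hp (by linarith) le_rfl, ?_⟩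
  let t : ℕ → ℝ := fun k => 1 / ((k:ℝ) + 1)
  have ht0 : ∀ k, 0 < t k := fun k => by positivity
  have ht1 : ∀ k, t k ≤ 1 := fun k => by
    simp only [t]; rw [div_le_one (by positivity)]; linarith [(Nat.cast_nonneg k : (0:ℝ) ≤ k)]
  have htl : Tendsto t atTop (𝓝 0) := tendsto_one_div_add_atTop_nhds_zero_nat
  have hql : Tendsto (fun k => p + t k) atTop (𝓝 p) := by simpa using htl.const_add p
  have hreg : ∀ k, ∫ x, Aq M φ a (p + t k) (t k) x ∂(surfMeasure M) ≤
      ∫ x, Bq M φ a (p + t k) (t k) x ∂(surfMeasure M) := fun k => by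
    have := ht0 k
    have := ht1 k
    exact hardy_reg M φ hφ a (p + t k) (t k) (by linarith) (ht0 k)
      (hAi _ _ (by linarith) (by linarith) (by linarith))
      (hBi _ _ (by linarith) (by linarith) (by linarith))
  have hwl : ∀ x : Eu n, x ≠ 0 → Tendsto (fun k => (‖x‖ ^ 2 + t k) ^ (-(a / 2))) atTop
      (𝓝 ((‖x‖ ^ 2 + 0) ^ (-(a / 2)))) := fun x hx => by
    apply Tendsto.rpow_const (htl.const_add _)
    left
    have := norm_pos_iff.2 hx
    positivity
  have hAl : ∀ x : Eu n, x ≠ 0 → Tendsto (fun k => Aq M φ a (p + t k) (t k) x) atTop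
      (𝓝 (Aq M φ a p 0 x)) := fun x hx => by
    have := norm_pos_iff.2 hx
    unfold Aq
    refine ((hwl x hx).mul ?_).mul ?_
    · exact tendsto_const_nhds.rpow hql (Or.inr (by linarith))
    · exact tendsto_const_nhds.sub (tendsto_const_nhds.div (htl.const_add _) (by positivity))
  have hA : Tendsto (fun k => ∫ x, Aq M φ a (p + t k) (t k) x ∂(surfMeasure M)) atTop
      (𝓝 (∫ x, Aq M φ a p 0 x ∂(surfMeasure M))) := by
    refine tendsto_integral_of_dominated_convergence _
      (fun k => (Aq_meas M φ hφc a _ _).aestronglyMeasurable) (hind.const_mul (m ^ (p + 1) * n)) ?_ ?_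
    · intro k
      filter_upwards [mem_ae M, zero_null M hn] with x h1 h2
      have := ht0 k
      have := ht1 k
      exact hAb _ _ (by linarith) (by linarith) (by linarith) x h1 h2
    · filter_upwards [zero_null M hn] with x h2 using hAl x h2
  let Z : Set (Eu n) := {x | φ x ≠ 0}
  have hZ : MeasurableSet Z := (isOpen_ne_fun hφc.continuous continuous_const).measurableSet
  have hB : Tendsto (fun k => ∫ x, Bq M φ a (p + t k) (t k) x ∂(surfMeasure M)) atTop
      (𝓝 (∫ x, Z.indicator (Bq M φ a p 0) x ∂(surfMeasure M))) := by
    refine tendsto_integral_of_dominated_convergence _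
      (fun k => (Bq_meas M φ hφc a _ _).aestronglyMeasurable) (hind.const_mul (m ^ p * (R * L))) ?_ ?_
    · intro k
      filter_upwards [mem_ae M, zero_null M hn] with x h1 h2
      have := ht0 k
      have := ht1 k
      exact hBb _ _ (by linarith) (by linarith) (by linarith) x h1 h2
    · filter_upwards [zero_null M hn] with x h2
      by_cases h : x ∈ Z
      · rw [indicator_of_mem h]
        unfold Bq
        refine ((hwl x h2).mul ?_).mul (Tendsto.const_mul _ ?_)
        · exact tendsto_const_nhds.rpow (hql.sub_const 1) (Or.inl (abs_ne_zero.2 h))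
        · unfold Gq
          exact ((hql.smul_const _).sub_const _).norm
      · rw [indicator_of_notMem h]
        have h0 : φ x = 0 := by simpa [Z] using h
        refine tendsto_const_nhds.congr fun k => ?_
        have := ht0 k
        rw [Bq, h0, abs_zero, Real.zero_rpow (by linarith)]; simp
  refine (le_of_tendsto_of_tendsto' hA hB hreg).trans ?_
  apply integral_mono ((hBi p 0 hp (by linarith) le_rfl).indicator hZ) (hBi p 0 hp (by linarith) le_rfl)
  intro x
  apply indicator_le_self' (f := Bq M φ a p 0)
  intro y _
  simp only [Bq, add_zero]
  positivity

end hardy2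

section final
open Measure Set Filter Topology Module
open scoped NNReal ENNReal ContDiff

theorem w0 (x : Eu n) (a : ℝ) : (‖x‖ ^ 2 + 0) ^ (-(a / 2)) = ‖x‖ ^ (-a) := by
  rw [add_zero, ← Real.rpow_natCast, ← Real.rpow_mul (norm_nonneg x)]; congr 1; push_cast; ring

theorem hardy_holder (M : Hypersurface n) (p a : ℝ) (hp : 1 ≤ p)
    (ha : 0 ≤ a) (han : a < n) (φ : Eu n → ℝ) (hφ : C1cOn M.carrier φ) :
    ∫ x, Bq M φ a p 0 x ∂(surfMeasure M) ≤
    (∫ x, |φ x| ^ p / ‖x‖ ^ a ∂surfMeasure M) ^ ((p - 1) / p)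
      * (∫ x, ‖Gq M φ p x‖ ^ p / ‖x‖ ^ (a - p) ∂surfMeasure M) ^ (1 / p) := by
  obtain ⟨hφc, K, hK, hKM, hφ0⟩ := id hφ
  have hn : 1 ≤ n := by
    have : (0:ℝ) < n := lt_of_le_of_lt ha han
    exact_mod_cast this
  have hp0 : 0 < p := by linarith
  rcases eq_or_lt_of_le hp with h1 | h1
  · subst h1
    simp only [sub_self, zero_div, Real.rpow_zero, one_mul, div_one, Real.rpow_one]
    apply le_of_eq
    apply integral_congr_ae
    filter_upwards [zero_null M hn] with x hx
    have hx' := norm_pos_iff.2 hx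
    rw [Bq, w0, sub_self, Real.rpow_zero, div_eq_mul_inv, ← Real.rpow_neg hx'.le,
      show -(a - 1) = -a + 1 by ring, Real.rpow_add_one hx'.ne']
    ring
  obtain ⟨m, hm1, hm⟩ := bdd_on K hK φ hφc.continuous
  obtain ⟨R, hR1, hR⟩ := bdd_on K hK id continuous_id
  obtain ⟨L, hL0, hL⟩ := Gq_bound M φ hφc K hK hKM p
  set f : Eu n → ℝ := fun x => |φ x| ^ (p - 1) * ‖x‖ ^ (-a * ((p - 1) / p)) with hf
  set g : Eu n → ℝ := fun x => ‖Gq M φ p x‖ * (‖x‖ * ‖x‖ ^ (-a * (1 / p))) with hg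
  have hfm : Measurable f :=
    (hφc.continuous.abs.measurable.pow_const _).mul (measurable_norm.pow_const _)
  have hgm : Measurable g :=
    (Gq_cont M φ hφc p).norm.measurable.mul (measurable_norm.mul (measurable_norm.pow_const _))
  have hf0 : ∀ x, 0 ≤ f x := fun x => by positivity
  have hg0 : ∀ x, 0 ≤ g x := fun x => by positivity
  have hpq : (p / (p - 1)).HolderConjugate p := by
    have := (Real.HolderConjugate.conjExponent h1).symm
    exact this
  have hp1 : 0 < p - 1 := by linarith
  have hfp : ∀ x, f x ^ (p / (p - 1)) = |φ x| ^ p / ‖x‖ ^ a := fun x => by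
    rw [hf]
    simp only
    rw [Real.mul_rpow (by positivity) (by positivity), ← Real.rpow_mul (abs_nonneg _),
      ← Real.rpow_mul (norm_nonneg _), div_eq_mul_inv (|φ x| ^ p), ← Real.rpow_neg (norm_nonneg _)]
    congr 2 <;> field_simp
  have hgp : ∀ x, g x ^ p = ‖Gq M φ p x‖ ^ p * (‖x‖ ^ p * ‖x‖ ^ (-a)) := fun x => by
    rw [hg]
    simp only
    rw [Real.mul_rpow (by positivity) (by positivity), Real.mul_rpow (by positivity) (by positivity),
      ← Real.rpow_mul (norm_nonneg x)]
    congr 3; field_simp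
  have hgp2 : ∀ x : Eu n, x ≠ 0 → ‖Gq M φ p x‖ ^ p * (‖x‖ ^ p * ‖x‖ ^ (-a)) =
      ‖Gq M φ p x‖ ^ p / ‖x‖ ^ (a - p) := fun x hx => by
    have hx' := norm_pos_iff.2 hx
    rw [← Real.rpow_add hx', div_eq_mul_inv, ← Real.rpow_neg hx'.le]; congr 2; ring
  have hfi : Integrable (fun x => f x ^ (p / (p - 1))) (surfMeasure M) := by
    refine ind_int M K hK hKM a ha han _ (hfm.pow_const _) (m ^ p) ?_
    intro x hx hx0
    rw [hfp, Real.norm_of_nonneg (by positivity), div_eq_mul_inv, ← Real.rpow_neg (norm_nonneg _)]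
    by_cases hxK : x ∈ K
    · rw [indicator_of_mem hxK]
      have := hm x hxK
      rw [Real.norm_eq_abs] at this
      gcongr
    · rw [hφ0 x hx hxK, abs_zero, Real.zero_rpow hp0.ne', indicator_of_notMem hxK]; simp
  have hgi : Integrable (fun x => g x ^ p) (surfMeasure M) := by
    refine ind_int M K hK hKM a ha han _ (hgm.pow_const _) (L ^ p * R ^ p) ?_
    intro x hx hx0
    rw [hgp, Real.norm_of_nonneg (by positivity)]
    by_cases hxK : x ∈ K
    · rw [indicator_of_mem hxK, mul_assoc]
      have t1 := hR x hxK
      have t2 := hL p hp0.le (by linarith) x hxK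
      simp only [id] at t1
      gcongr
    · rw [Gq_zero M φ hφc K hK hφ0 p x hx hxK, norm_zero, Real.zero_rpow hp0.ne',
        indicator_of_notMem hxK]; simp
  have hml : ∀ (h : Eu n → ℝ) (r : ℝ), 0 < r → Measurable h → (∀ x, 0 ≤ h x) →
      Integrable (fun x => h x ^ r) (surfMeasure M) → MemLp h (ENNReal.ofReal r) (surfMeasure M) := by
    intro h r hr hm h0 hi
    rw [← integrable_norm_rpow_iff hm.aestronglyMeasurable (by simpa using hr) ENNReal.ofReal_ne_top,
      ENNReal.toReal_ofReal hr.le]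
    simpa only [Real.norm_of_nonneg (h0 _)] using hi
  have key := integral_mul_le_Lp_mul_Lq_of_nonneg hpq (Eventually.of_forall hf0)
    (Eventually.of_forall hg0) (hml f _ (by positivity) hfm hf0 hfi) (hml g p hp0 hgm hg0 hgi)
  have e1 : ∫ x, Bq M φ a p 0 x ∂(surfMeasure M) = ∫ x, f x * g x ∂(surfMeasure M) := by
    apply integral_congr_ae
    filter_upwards [zero_null M hn] with x hx
    have hx' := norm_pos_iff.2 hx
    rw [Bq, w0, hf, hg]
    simp only
    have : ‖x‖ ^ (-a) = ‖x‖ ^ (-a * ((p - 1) / p)) * ‖x‖ ^ (-a * (1 / p)) := by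
      rw [← Real.rpow_add hx']; congr 1; field_simp; ring
    rw [this]; ring
  have e2 : ∫ x, g x ^ p ∂(surfMeasure M) =
      ∫ x, ‖Gq M φ p x‖ ^ p / ‖x‖ ^ (a - p) ∂surfMeasure M := by
    apply integral_congr_ae
    filter_upwards [zero_null M hn] with x hx
    rw [hgp, hgp2 x hx]
  rw [e1]
  refine key.trans (le_of_eq ?_)
  rw [e2]
  simp only [hfp, one_div_div]

end final

theorem hardy_ibp (M : Hypersurface n) (p a : ℝ) (hp : 1 ≤ p)
    (ha : 0 ≤ a) (han : a < n) (φ : Eu n → ℝ) (hφ : C1cOn M.carrier φ) :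
    ((n : ℝ) - a) * ∫ x, |φ x| ^ p / ‖x‖ ^ a ∂surfMeasure M
      + a * ∫ x, (⟪x, M.nu x⟫ / ‖x‖) ^ 2 * (|φ x| ^ p / ‖x‖ ^ a) ∂surfMeasure M
    ≤ (∫ x, |φ x| ^ p / ‖x‖ ^ a ∂surfMeasure M) ^ ((p - 1) / p)
      * (∫ x, ‖p • tgrad M.nu φ x - (meanCurv M x * φ x) • M.nu x‖ ^ p / ‖x‖ ^ (a - p)
          ∂surfMeasure M) ^ (1 / p) := by
  obtain ⟨hA, hB, hle⟩ := hardy_limit M p a hp ha han φ hφ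
  refine le_trans (le_of_eq ?_) (hle.trans (hardy_holder M p a hp ha han φ hφ))
  obtain ⟨hφc, K, hK, hKM, hφ0⟩ := id hφ
  have hn : 1 ≤ n := by
    have : (0:ℝ) < n := lt_of_le_of_lt ha han
    exact_mod_cast this
  obtain ⟨m, hm1, hm⟩ := bdd_on K hK φ hφc.continuous
  have hp0 : 0 < p := by linarith
  have hφm : Measurable (fun x => |φ x| ^ p / ‖x‖ ^ a) :=
    (hφc.continuous.abs.measurable.pow_const _).div (measurable_norm.pow_const _)
  have hs3 : Measurable (fun x => (⟪x, M.nu x⟫ : ℝ)) :=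
    (continuous_id.inner M.smooth_nu.continuous).measurable
  have hb1 : ∀ x ∈ M.carrier, x ≠ 0 → |φ x| ^ p / ‖x‖ ^ a ≤
      m ^ p * K.indicator (fun x => ‖x‖ ^ (-a)) x := by
    intro x hx hx0
    rw [div_eq_mul_inv, ← Real.rpow_neg (norm_nonneg _)]
    by_cases hxK : x ∈ K
    · rw [Set.indicator_of_mem hxK]
      have := hm x hxK
      rw [Real.norm_eq_abs] at this
      gcongr
    · rw [hφ0 x hx hxK, abs_zero, Real.zero_rpow hp0.ne', Set.indicator_of_notMem hxK]; simp
  have i1 : Integrable (fun x => |φ x| ^ p / ‖x‖ ^ a) (surfMeasure M) := by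
    refine ind_int M K hK hKM a ha han _ hφm (m ^ p) fun x hx hx0 => ?_
    rw [Real.norm_of_nonneg (by positivity)]
    exact hb1 x hx hx0
  have i2 : Integrable (fun x => (⟪x, M.nu x⟫ / ‖x‖) ^ 2 * (|φ x| ^ p / ‖x‖ ^ a)) (surfMeasure M) := by
    refine ind_int M K hK hKM a ha han _ (((hs3.div measurable_norm).pow_const 2).mul hφm) (m ^ p)
      fun x hx hx0 => ?_
    rw [Real.norm_of_nonneg (by positivity)]
    refine le_trans ?_ (hb1 x hx hx0)
    apply mul_le_of_le_one_left (by positivity)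
    have h1 := abs_real_inner_le_norm x (M.nu x)
    rw [M.unit_nu x hx, mul_one] at h1
    rw [sq_le_one_iff_abs_le_one, abs_div, abs_norm]
    exact div_le_one_of_le₀ h1 (norm_nonneg _)
  rw [← integral_const_mul, ← integral_const_mul, ← integral_add (i1.const_mul _) (i2.const_mul _)]
  apply integral_congr_ae
  filter_upwards [zero_null M hn] with x hx
  have hx' := norm_pos_iff.2 hx
  rw [Aq, w0, div_eq_mul_inv (|φ x| ^ p), ← Real.rpow_neg hx'.le, add_zero]
  field_simp
  ring
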